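/- Let (g,[·,·],⟨·,·⟩) be a Lorentzian 2-step nilpotent Lie algebra such that Z(g) = [g,g] is nondegenerate Lorentzian (the restriction of ⟨·,·⟩ to [g,g] is nondegenerate of signature (1, dim[g,g] − 1)), and let ω : g × g → ℝ be a 2-cocycle. Then g is ω-quasi Einstein of type 1 with Einstein constant λ ≥ 0 if and only if λ = 0 and, up to an isomorphism, (g,[·,·],⟨·,·⟩,ω) has one of the following two forms: (1) dim g = 5 and there is an orthonormal basis {e₁,e₂,u₁,u₂,u₃} of g with ⟨e₁,e₁⟩ = −1 such that the only non-vanishing brackets and ω-products are [u₁,u₂] = α e₂, [u₂,u₃] = ±α e₁, ω(e₂,u₃) = εα, ω(e₁,u₁) = ∓εα, for some α ≠ 0 and ε = ±1; (2) dim g = 6 and there is an orthonormal basis {e₁,e₂,e₃,u₁,u₂,u₃} of g with ⟨e₁,e₁⟩ = −1 such that the only non-vanishing brackets and ω-products are [u₁,u₂] = α₂ e₂, [u₁,u₃] = α₃ e₃, [u₂,u₃] = εα e₁, ω(e₂,u₃) = ∓εα₂, ω(e₃,u₂) = ±εα₃, ω(e₁,u₁) = ±α, where α₂, α₃ ≠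 0, ε = ±1 and α = √(α₂² + α₃²) (the ± and ∓ signs being correlated). -/

import Mathlib

open Module LinearMap

noncomputable section

/-- A bilinear form is Lorentzian if it admits an orthonormal basis with exactly one
timelike vector, i.e. it has signature `(1, dim − 1)`. -/
def IsLorentzianForm {G : Type*} [AddCommGroup G] [Module ℝ G]
    (B : G →ₗ[ℝ] G →ₗ[ℝ] ℝ) : Prop :=
  ∃ (n : ℕ) (b : Basis (Fin (n + 1)) ℝ G),
    (∀ i j, i ≠ j → B (b i) (b j) = 0) ∧
    B (b 0) (b 0) = -1 ∧ ∀ i, i ≠ 0 → B (b i) (b i) = 1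

/-- The derived ideal `[g,g]` viewed as the submodule spanned by all brackets. -/
def derivedSubmodule (G : Type*) [LieRing G] [LieAlgebra ℝ G] : Submodule ℝ G :=
  Submodule.span ℝ {x : G | ∃ u v : G, x = ⁅u, v⁆}


/-- A positive definite symmetric form and a second symmetric form are simultaneously
diagonalizable. -/
theorem exists_simultaneous_orthogonal_basis {V : Type*} [AddCommGroup V] [Module ℝ V]
    [Module.Finite ℝ V] (P Q : V →ₗ[ℝ] V →ₗ[ℝ] ℝ) (hP : ∀ u v, P u v = P v u)
    (hpos : ∀ v, v ≠ 0 → 0 < P v v) (hQ : ∀ u v, Q u v = Q v u) :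
    ∃ (n : ℕ) (f : Basis (Fin n) ℝ V),
      (∀ i j, P (f i) (f j) = if i = j then 1 else 0) ∧ ∀ i j, i ≠ j → Q (f i) (f j) = 0 := by
  have hnonneg : ∀ v, 0 ≤ P v v := fun v => by
    by_cases h : v = 0
    · simp [h]
    · exact (hpos v h).le
  let core : InnerProductSpace.Core ℝ V :=
    { inner := fun u v => P u v
      conj_inner_symm := fun u v => by simpa using hP v u
      re_inner_nonneg := fun v => by simpa using hnonneg v
      add_left := fun u v w => by simp
      smul_left := fun u v r => by simp
      definite := fun v hv => by
        by_contra h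
        exact (hpos v h).ne' hv }
  let : NormedAddCommGroup V := core.toNormedAddCommGroup
  let : InnerProductSpace ℝ V := InnerProductSpace.ofCore core.toCore
  have hinner : ∀ u v : V, inner ℝ u v = P u v := fun u v => rfl
  have hPnd : LinearMap.BilinForm.Nondegenerate P := by
    refine ⟨fun v h => ?_, fun v h => ?_⟩ <;>
    · by_contra hv
      exact (hpos v hv).ne' (h v)
  let T : V →ₗ[ℝ] V := LinearMap.BilinForm.symmCompOfNondegenerate Q P hPnd
  have hT : ∀ u v, P (T u) v = Q u v := fun u v =>
    LinearMap.BilinForm.symmCompOfNondegenerate_left_apply Q hPnd v u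
  have hTs : T.IsSymmetric := fun u v => by
    rw [hinner, hinner, hT, hP, hT, hQ]
  refine ⟨Module.finrank ℝ V, (hTs.eigenvectorBasis rfl).toBasis, fun i j => ?_, fun i j hij => ?_⟩
  · simpa [hinner] using (orthonormal_iff_ite.1 (hTs.eigenvectorBasis rfl).orthonormal) i j
  · have h := hT (hTs.eigenvectorBasis rfl i) (hTs.eigenvectorBasis rfl j)
    have h0 := (orthonormal_iff_ite.1 (hTs.eigenvectorBasis rfl).orthonormal) i j
    rw [hinner, if_neg hij] at h0
    rw [hTs.apply_eigenvectorBasis] at h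
    simp only [OrthonormalBasis.coe_toBasis]
    rw [← h]
    simp [h0]

section Orthonormal

variable {G : Type*} [AddCommGroup G] [Module ℝ G] (B : G →ₗ[ℝ] G →ₗ[ℝ] ℝ)

theorem IsLorentzianForm.pos_of_orthogonal_timelike {B : G →ₗ[ℝ] G →ₗ[ℝ] ℝ}
    (hB : IsLorentzianForm B) {t v : G}
    (ht : B t t < 0) (htv : B t v = 0) (hv : v ≠ 0) : 0 < B v v := by
  obtain ⟨n, b, horth, h0, h1⟩ := hB
  have key : ∀ p q, B p q = -(b.repr p 0 * b.repr q 0)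
      + ∑ i : Fin n, b.repr p i.succ * b.repr q i.succ := fun p q => by
    have hij : ∀ i j, B (b i) (b j) = if i = j then (if i = 0 then -1 else 1) else 0 := by
      intro i j
      split_ifs with h h'
      · subst h; subst h'; exact h0
      · subst h; exact h1 i h'
      · exact horth i j h
    conv_lhs => rw [← b.sum_repr p, ← b.sum_repr q]
    simp only [map_sum, LinearMap.sum_apply, map_smul, LinearMap.smul_apply, hij, smul_eq_mul]
    simp [Fin.sum_univ_succ, mul_comm]
  rw [key] at ht htv ⊢
  have hcs := Finset.sum_mul_sq_le_sq_mul_sq Finset.univ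
    (fun i : Fin n => b.repr t i.succ) (fun i : Fin n => b.repr v i.succ)
  set X := ∑ i : Fin n, b.repr t i.succ * b.repr v i.succ
  simp only [← pow_two] at ht ⊢
  set Y := ∑ i : Fin n, b.repr t i.succ ^ 2
  set Z := ∑ i : Fin n, b.repr v i.succ ^ 2 with hZ
  by_contra hcon
  have hZ0 : 0 ≤ Z := Finset.sum_nonneg fun i _ => sq_nonneg _
  have hY0 : 0 ≤ Y := Finset.sum_nonneg fun i _ => sq_nonneg _
  have hX : X = b.repr t 0 * b.repr v 0 := by linarith
  rw [hX] at hcs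
  have hs : b.repr v 0 ^ 2 = 0 := by
    have : 0 ≤ b.repr v 0 ^ 2 := sq_nonneg _
    nlinarith
  have hZz : Z = 0 := by linarith
  apply hv
  apply b.repr.injective
  ext i
  rw [hZ, Finset.sum_eq_zero_iff_of_nonneg fun i _ => sq_nonneg _] at hZz
  refine Fin.cases ?_ (fun i => ?_) i
  · simpa using hs
  · simpa using hZz i (Finset.mem_univ _)

variable {B} {ι : Type*} [Fintype ι] [DecidableEq ι] {σ : ι → ℝ}

theorem exists_basis_of_orthonormal (v : ι → G) (hσ : ∀ i, σ i * σ i = 1)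
    (hv : ∀ i j, B (v i) (v j) = if i = j then σ i else 0)
    (hspan : ∀ p, (∀ i, B p (v i) = 0) → p = 0) :
    ∃ b : Basis ι ℝ G, ∀ i, b i = v i := by
  have hli : LinearIndependent ℝ v := by
    rw [Fintype.linearIndependent_iff]
    intro g hg i
    have h := congrArg (fun p => B p (v i)) hg
    have hi := hσ i
    simp [hv] at h
    rcases h with h | h
    · exact h
    · simp [h] at hi
  refine ⟨Basis.mk hli fun p _ => ?_, fun i => Basis.mk_apply _ _ i⟩
  have h := hspan (p - ∑ i, (σ i * B p (v i)) • v i) fun i => by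
    simp only [map_sub, LinearMap.sub_apply, map_sum, LinearMap.sum_apply, map_smul,
      LinearMap.smul_apply, hv, smul_eq_mul, mul_ite, mul_zero, Finset.sum_ite_eq',
      Finset.mem_univ, if_true]
    linear_combination (-B p (v i)) * hσ i
  rw [sub_eq_zero.1 h]
  exact Submodule.sum_mem _ fun i _ => Submodule.smul_mem _ _ (Submodule.subset_span ⟨i, rfl⟩)

variable (b : Basis ι ℝ G) (hσ : ∀ i, σ i * σ i = 1)
  (hb : ∀ i j, B (b i) (b j) = if i = j then σ i else 0)

include hσ hb

theorem repr_eq_of_orthonormal (p : G) (i : ι) : b.repr p i = σ i * B p (b i) := by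
  have h : B p (b i) = b.repr p i * σ i := by
    conv_lhs => rw [← b.sum_repr p]
    simp only [map_sum, LinearMap.sum_apply, map_smul, LinearMap.smul_apply, hb, smul_eq_mul,
      mul_ite, mul_zero, Finset.sum_ite_eq', Finset.mem_univ, if_true]
  rw [h]
  linear_combination (-(b.repr p i)) * hσ i

theorem eq_sum_of_orthonormal (p : G) : p = ∑ i, (σ i * B p (b i)) • b i := by
  conv_lhs => rw [← b.sum_repr p]
  simp only [repr_eq_of_orthonormal b hσ hb]

theorem form_eq_sum_of_orthonormal (p q : G) :
    B p q = ∑ i, σ i * (B p (b i) * B q (b i)) := by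
  conv_lhs => rw [eq_sum_of_orthonormal b hσ hb p, eq_sum_of_orthonormal b hσ hb q]
  simp [hb, -LinearMap.map_smulₛₗ, map_smul]
  refine Finset.sum_congr rfl fun i _ => ?_
  linear_combination (B p (b i) * B q (b i) * σ i) * hσ i

theorem trace_eq_sum_of_orthonormal (T : Module.End ℝ G) :
    LinearMap.trace ℝ G T = ∑ i, σ i * B (T (b i)) (b i) := by
  rw [LinearMap.trace_eq_matrix_trace ℝ b, Matrix.trace]
  simp [LinearMap.toMatrix_apply, repr_eq_of_orthonormal b hσ hb]

end Orthonormal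

section Ricci

variable {G : Type*} [LieRing G] [LieAlgebra ℝ G] {B : G →ₗ[ℝ] G →ₗ[ℝ] ℝ}
  {ι : Type*} [Fintype ι] [DecidableEq ι] {σ : ι → ℝ}
  (b : Basis ι ℝ G) (hσ : ∀ i, σ i * σ i = 1)
  (hb : ∀ i j, B (b i) (b j) = if i = j then σ i else 0)

include hσ hb

theorem trace_ad_comp_adjoint [Module.Finite ℝ G]
    {adStar : G → Module.End ℝ G}
    (hadStar : ∀ u v w : G, B (adStar u v) w = B v ⁅u, w⁆) (u v : G) :
    LinearMap.trace ℝ G ((LieAlgebra.ad ℝ G u : Module.End ℝ G) ∘ₗ adStar v)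
      = ∑ i, σ i * B ⁅u, b i⁆ ⁅v, b i⁆ := by
  rw [LinearMap.trace_comp_comm', trace_eq_sum_of_orthonormal b hσ hb]
  simp [hadStar]

theorem trace_J_comp_J {Jm : G → Module.End ℝ G}
    (hJm : ∀ u v w : G, B (Jm u v) w = B u ⁅v, w⁆) (u v : G) :
    LinearMap.trace ℝ G (Jm u ∘ₗ Jm v)
      = -∑ i, ∑ j, σ i * (σ j * (B u ⁅b i, b j⁆ * B v ⁅b i, b j⁆)) := by
  rw [trace_eq_sum_of_orthonormal b hσ hb, ← Finset.sum_neg_distrib]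
  refine Finset.sum_congr rfl fun i _ => ?_
  rw [← Finset.mul_sum, ← mul_neg, LinearMap.comp_apply, hJm, ← lie_skew, map_neg, ← hJm,
    form_eq_sum_of_orthonormal b hσ hb]
  simp only [hJm]

theorem form_skew_sq {ω : G →ₗ[ℝ] G →ₗ[ℝ] ℝ} (hωskew : ∀ u v, ω u v = -ω v u)
    {S : Module.End ℝ G} (hS : ∀ u v : G, B (S u) v = ω u v) (u v : G) :
    B (-(S (S u))) v = ∑ i, σ i * (ω u (b i) * ω v (b i)) := by
  have hsymm : B (S v) (S u) = B (S u) (S v) := by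
    rw [form_eq_sum_of_orthonormal b hσ hb, form_eq_sum_of_orthonormal b hσ hb (S u)]
    simp only [mul_comm]
  rw [map_neg, LinearMap.neg_apply, hS, hωskew, neg_neg, ← hS, hsymm,
    form_eq_sum_of_orthonormal b hσ hb]
  simp only [hS]

theorem trace_skew_sq {ω : G →ₗ[ℝ] G →ₗ[ℝ] ℝ} (hωskew : ∀ u v, ω u v = -ω v u)
    {S : Module.End ℝ G} (hS : ∀ u v : G, B (S u) v = ω u v) :
    LinearMap.trace ℝ G (S ∘ₗ S)
      = -∑ i, ∑ j, σ i * (σ j * (ω (b i) (b j) * ω (b i) (b j))) := by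
  rw [trace_eq_sum_of_orthonormal b hσ hb, ← Finset.sum_neg_distrib]
  refine Finset.sum_congr rfl fun i _ => ?_
  have h := form_skew_sq b hσ hb hωskew hS (b i) (b i)
  rw [map_neg, LinearMap.neg_apply] at h
  rw [← Finset.mul_sum, LinearMap.comp_apply, ← h]
  ring

end Ricci

/-- The signature of an orthonormal basis whose distinguished vector `inl none` is timelike. -/
def lorentzSign {K Y : Type*} : Option K ⊕ Option Y → ℝ
  | Sum.inl none => -1
  | Sum.inl (some _) => 1
  | Sum.inr _ => 1

theorem lorentzSign_mul_self {K Y : Type*} (i : Option K ⊕ Option Y) :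
    lorentzSign i * lorentzSign i = 1 := by
  rcases i with (_ | _) | _ <;> simp [lorentzSign]

theorem Submodule.eq_sum_repr {G ι : Type*} [AddCommGroup G] [Module ℝ G] [Fintype ι]
    {W : Submodule ℝ G} (f : Basis ι ℝ W) (p : G) (hp : p ∈ W) :
    p = ∑ i, f.repr ⟨p, hp⟩ i • (f i : G) := by
  have := congrArg (fun w : W => (w : G)) (f.sum_repr ⟨p, hp⟩)
  simpa only [Submodule.coe_sum, Submodule.coe_smul] using this.symm

theorem exists_adapted_basis {G : Type*} [AddCommGroup G] [Module ℝ G] [Module.Finite ℝ G]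
    {B : G →ₗ[ℝ] G →ₗ[ℝ] ℝ} (hsymm : ∀ u v, B u v = B v u) (hB : IsLorentzianForm B)
    (W : Submodule ℝ G) {t : G} (htW : t ∈ W) (ht : B t t < 0) (S : Module.End ℝ G)
    (hSW : ∀ z ∈ W, ∀ w ∈ W, B (S z) w = 0) (hSinj : ∀ z ∈ W, S z = 0 → z = 0) :
    ∃ (K Y : Type) (_ : Fintype K) (_ : Fintype Y) (_ : DecidableEq K) (_ : DecidableEq Y)
      (b : Basis (Option K ⊕ Option Y) ℝ G),
      (∀ i j, B (b i) (b j) = if i = j then lorentzSign i else 0) ∧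
      (∀ k, b (Sum.inl k) ∈ W) ∧ (∀ z ∈ W, ∀ i, B z (b (Sum.inr i)) = 0) ∧
      (∀ k l, k ≠ l → B (S (b (Sum.inl k))) (S (b (Sum.inl l))) = 0) ∧
      (∀ y, B (S (b (Sum.inl none))) (b (Sum.inr (some y))) = 0) ∧
      B (S (b (Sum.inl none))) (b (Sum.inr none)) ≠ 0 := by
  classical
  have hperp : ∀ p, (∀ z ∈ W, B z p = 0) → p ≠ 0 → 0 < B p p := fun p hp hp0 =>
    hB.pos_of_orthogonal_timelike ht (hp t htW) hp0
  obtain ⟨n, f, hf, hfB⟩ := exists_simultaneous_orthogonal_basis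
    (B.compl₁₂ (S ∘ₗ W.subtype) (S ∘ₗ W.subtype)) (B.compl₁₂ W.subtype W.subtype)
    (fun u v => by simp [hsymm (S u)])
    (fun v hv => by
      have h0 : S v ≠ 0 := fun h => hv (by simpa using hSinj v v.2 h)
      simpa using hperp (S v) (fun z hz => by rw [hsymm]; exact hSW v v.2 z hz) h0)
    (fun u v => by simp [hsymm (u : G)])
  simp only [LinearMap.compl₁₂_apply, LinearMap.comp_apply, Submodule.subtype_apply] at hf hfB
  obtain ⟨i₀, hi₀⟩ : ∃ i, B (f i : G) (f i) < 0 := by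
    by_contra! hcon
    refine ht.not_ge ?_
    have hrep := W.eq_sum_repr f t htW
    have hval : B t t = ∑ i, f.repr ⟨t, htW⟩ i ^ 2 * B (f i : G) (f i) := by
      conv_lhs => rw [hrep]
      simp only [map_sum, LinearMap.sum_apply, map_smul, LinearMap.smul_apply, smul_eq_mul]
      refine Finset.sum_congr rfl fun i _ => ?_
      rw [Finset.sum_eq_single i (fun j _ hj => by rw [hfB j i hj]; ring) (by simp)]
      ring
    rw [hval]
    exact Finset.sum_nonneg fun i _ => mul_nonneg (sq_nonneg _) (hcon i)
  have hpos : ∀ i, i ≠ i₀ → 0 < B (f i : G) (f i) := fun i hi =>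
    hB.pos_of_orthogonal_timelike hi₀ (hfB i₀ i hi.symm) fun h => f.ne_zero i (by simpa using h)
  have hfin : ∀ i, B (f i : G) (f i) ≠ 0 := fun i => by
    by_cases h : i = i₀
    · subst h; exact hi₀.ne
    · exact (hpos i h).ne'
  let e : Fin n → G := fun i => (Real.sqrt |B (f i : G) (f i)|)⁻¹ • (f i : G)
  have hc0 : ∀ i, (Real.sqrt |B (f i : G) (f i)|)⁻¹ ≠ 0 := fun i =>
    inv_ne_zero (Real.sqrt_ne_zero'.2 (abs_pos.2 (hfin i)))
  have heW : ∀ i, e i ∈ W := fun i => W.smul_mem _ (f i).2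
  have heB : ∀ i j, i ≠ j → B (e i) (e j) = 0 := fun i j hij => by
    simp [e, hfB i j hij]
  have hee : ∀ i, B (e i) (e i) = B (f i : G) (f i) / |B (f i : G) (f i)| := fun i => by
    have h1 := Real.mul_self_sqrt (abs_nonneg (B (f i : G) (f i)))
    have h2 : Real.sqrt |B (f i : G) (f i)| ≠ 0 := Real.sqrt_ne_zero'.2 (abs_pos.2 (hfin i))
    simp only [e, map_smul, LinearMap.smul_apply, smul_eq_mul]
    conv_rhs => rw [← h1]
    field_simp
  have he0 : B (e i₀) (e i₀) = -1 := by
    rw [hee, abs_of_neg hi₀, div_neg, div_self (hfin _)]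
  have he1 : ∀ i, i ≠ i₀ → B (e i) (e i) = 1 := fun i hi => by
    rw [hee, abs_of_pos (hpos i hi), div_self (hfin _)]
  have heS : ∀ i j, i ≠ j → B (S (e i)) (S (e j)) = 0 := fun i j hij => by
    simp [e, hf, hij]
  have heperp : ∀ p, (∀ i, B (e i) p = 0) → ∀ z ∈ W, B z p = 0 := fun p hp z hz => by
    rw [W.eq_sum_repr f z hz]
    simp only [map_sum, LinearMap.sum_apply, map_smul, LinearMap.smul_apply]
    refine Finset.sum_eq_zero fun i _ => ?_
    have := hp i
    simp only [e, map_smul, LinearMap.smul_apply, smul_eq_mul, mul_eq_zero, hc0, false_or] at this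
    rw [this, smul_zero]
  let A : Submodule ℝ G := W.orthogonalBilin B
  have hA : ∀ p, p ∈ A ↔ ∀ z ∈ W, B z p = 0 := fun p => Iff.rfl
  let φ : A →ₗ[ℝ] ℝ := B (S (e i₀)) ∘ₗ A.subtype
  obtain ⟨m, g, hg, hgφ⟩ := exists_simultaneous_orthogonal_basis
    (B.compl₁₂ A.subtype A.subtype) (φ.smulRight φ)
    (fun u v => by simp [hsymm (u : G)])
    (fun v hv => by simpa using hperp v v.2 fun h => hv (by simpa using h))
    (fun u v => by simp [mul_comm])
  simp only [LinearMap.compl₁₂_apply, Submodule.subtype_apply] at hg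
  have hAzero : ∀ q, ∀ p ∈ A, (∀ j, B q (g j) = 0) → B q p = 0 := fun q p hp h => by
    rw [A.eq_sum_repr g p hp]
    simp [h]
  obtain ⟨j₀, hj₀⟩ : ∃ j, B (S (e i₀)) (g j) ≠ 0 := by
    by_contra! hcon
    have hmem : S (e i₀) ∈ A := fun z hz => by
      have := hSW _ (heW i₀) z hz
      rw [hsymm] at this
      exact this
    have hz : S (e i₀) = 0 := by
      by_contra hne
      exact (hperp _ ((hA _).1 hmem) hne).ne' (hAzero _ _ hmem hcon)
    have h0 := hSinj _ (heW i₀) hz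
    rw [h0] at he0
    simp at he0
  have hj1 : ∀ j, j ≠ j₀ → B (S (e i₀)) (g j) = 0 := fun j hj => by
    have := hgφ j j₀ hj
    simpa [φ, hj₀] using this
  let v : Option {i // i ≠ i₀} ⊕ Option {j // j ≠ j₀} → G :=
    Sum.elim (fun k => e (Equiv.optionSubtypeNe i₀ k)) fun y => g (Equiv.optionSubtypeNe j₀ y)
  have hv : ∀ i j, B (v i) (v j) = if i = j then lorentzSign i else 0 := by
    rintro (k | y) (l | w)
    · simp only [v, Sum.elim_inl, Sum.inl.injEq]
      split_ifs with h
      · subst h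
        rcases k with _ | k
        · simpa [lorentzSign] using he0
        · simpa [lorentzSign] using he1 _ k.2
      · exact heB _ _ fun h' => h ((Equiv.injective _) h')
    · simpa [v] using (g _).2 _ (heW _)
    · rw [hsymm]
      simpa [v] using (g _).2 _ (heW _)
    · simp only [v, Sum.elim_inr, Sum.inr.injEq, hg, EmbeddingLike.apply_eq_iff_eq]
      simp [lorentzSign]
  obtain ⟨b, hb⟩ := exists_basis_of_orthonormal v lorentzSign_mul_self hv
    (fun p hp => by
      have hpA : p ∈ A := (hA p).2 <| heperp p fun i => by
        have := hp (Sum.inl ((Equiv.optionSubtypeNe i₀).symm i))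
        rw [hsymm]
        simpa only [v, Sum.elim_inl, Equiv.apply_symm_apply] using this
      by_contra hne
      refine (hperp p ((hA _).1 hpA) hne).ne' (hAzero _ _ hpA fun j => ?_)
      have := hp (Sum.inr ((Equiv.optionSubtypeNe j₀).symm j))
      simpa only [v, Sum.elim_inr, Equiv.apply_symm_apply] using this)
  have hbl : ∀ k, b (Sum.inl k) = e (Equiv.optionSubtypeNe i₀ k) := fun k => hb _
  have hbr : ∀ y, b (Sum.inr y) = g (Equiv.optionSubtypeNe j₀ y) := fun y => hb _
  refine ⟨{i // i ≠ i₀}, {j // j ≠ j₀}, inferInstance, inferInstance, inferInstance,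
    inferInstance, b, fun i j => by rw [hb, hb, hv], fun k => ?_, fun z hz y => ?_, fun k l hkl => ?_, fun y => ?_, ?_⟩
  · rw [hbl]
    exact heW _
  · rw [hbr]
    exact (g _).2 z hz
  · rw [hbl, hbl]
    exact heS _ _ fun h => hkl ((Equiv.injective _) h)
  · rw [hbl, hbr]
    exact hj1 _ y.2
  · rw [hbl, hbr]
    exact hj₀

theorem einstein_constant_eq_zero {K Y : Type*} [Fintype K] [Fintype Y]
    {J₀ F : Option Y → Option Y → ℝ} {J : K → Option Y → Option Y → ℝ} {a : K → Y → ℝ}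
    {μ lam : ℝ} (hlam : 0 ≤ lam) (hJ : ∀ k i j, J k i j = -J k j i)
    (h₀ : ∑ i, ∑ j, J₀ i j ^ 2 = 2 * μ ^ 2 - 4 * lam)
    (hK : ∀ k, ∑ i, ∑ j, J k i j ^ 2 = 4 * lam + 2 * ∑ y, a k y ^ 2)
    (hnone : ∑ m, J₀ none m ^ 2 - ∑ k, ∑ m, J k none m ^ 2 = 2 * lam - μ ^ 2)
    (hsome : ∀ y, ∑ m, J₀ (some y) m ^ 2 - ∑ k, ∑ m, J k (some y) m ^ 2
      = 2 * lam + ∑ k, a k y ^ 2 + ∑ m, F (some y) m ^ 2)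
    (hF : ∀ j, F none j = 0)
    (htr : -μ ^ 2 + ∑ k, ∑ y, a k y ^ 2 + (1 / 2) * ∑ i, ∑ j, F i j ^ 2 = 2 * lam) :
    lam = 0 ∧ (∀ i j, F i j = 0) ∧ (∀ j, J₀ none j = 0) ∧
      (∀ k y y', J k (some y) (some y') = 0) ∧ (μ ^ 2 = ∑ k, ∑ y, a k y ^ 2) ∧
      ∀ k, ∑ y, J k none (some y) ^ 2 = ∑ y, a k y ^ 2 := by
  have hJ0 : ∀ k i, J k i i = 0 := fun k i => by linarith [hJ k i i]
  have hK' : ∀ k, 2 * ∑ m, J k none m ^ 2 + ∑ y, ∑ y', J k (some y) (some y') ^ 2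
      = 4 * lam + 2 * ∑ y, a k y ^ 2 := fun k => by
    rw [← hK k]
    simp only [Fintype.sum_option, hJ0, Finset.sum_add_distrib, hJ k (some _) none, neg_sq]
    ring
  have hR : ∀ k, 0 ≤ ∑ y, ∑ y', J k (some y) (some y') ^ 2 := fun k =>
    Finset.sum_nonneg fun _ _ => Finset.sum_nonneg fun _ _ => sq_nonneg _
  have hRs := Finset.sum_nonneg fun k (_ : k ∈ Finset.univ) => hR k
  have hN : 0 ≤ ∑ m, J₀ none m ^ 2 := Finset.sum_nonneg fun _ _ => sq_nonneg _
  have hΦ : ∑ i, ∑ j, F i j ^ 2 = ∑ y, ∑ m, F (some y) m ^ 2 := by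
    rw [Fintype.sum_option]
    simp [hF]
  have e1 := Finset.sum_congr rfl fun k (_ : k ∈ Finset.univ) => hK k
  have e2 := Finset.sum_congr rfl fun k (_ : k ∈ Finset.univ) => hK' k
  have e3 := Finset.sum_congr rfl fun y (_ : y ∈ Finset.univ) => hsome y
  simp only [Finset.sum_add_distrib, Finset.sum_sub_distrib, ← Finset.mul_sum, Finset.sum_const,
    nsmul_eq_mul, Finset.card_univ] at e1 e2 e3
  rw [Finset.sum_comm (f := fun y k => a k y ^ 2), ← hΦ] at e3
  rw [Finset.sum_comm (f := fun y k => ∑ m, J k (some y) m ^ 2)] at e3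
  simp only [Fintype.sum_option (f := fun i => ∑ j, J _ i j ^ 2), Finset.sum_add_distrib] at e1
  rw [Fintype.sum_option] at h₀
  have hq : (0 : ℝ) ≤ Fintype.card K * lam := by positivity
  have hn : (0 : ℝ) ≤ Fintype.card Y * lam := by positivity
  have hl : lam = 0 := by linarith
  subst hl
  have hN0 : ∑ m, J₀ none m ^ 2 = 0 := by linarith
  have hRs0 : ∑ k, ∑ y, ∑ y', J k (some y) (some y') ^ 2 = 0 := by linarith
  have hμ : μ ^ 2 = ∑ k, ∑ y, a k y ^ 2 := by linarith
  have hF0 : ∑ i, ∑ j, F i j ^ 2 = 0 := by linarith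
  rw [Finset.sum_eq_zero_iff_of_nonneg fun k _ => hR k] at hRs0
  refine ⟨rfl, fun i j => ?_, fun j => ?_, fun k y y' => ?_, hμ, fun k => ?_⟩
  · rw [Finset.sum_eq_zero_iff_of_nonneg fun _ _ => Finset.sum_nonneg fun _ _ => sq_nonneg _]
      at hF0
    have := hF0 i (Finset.mem_univ _)
    rw [Finset.sum_eq_zero_iff_of_nonneg fun _ _ => sq_nonneg _] at this
    exact pow_eq_zero_iff two_ne_zero |>.1 (this j (Finset.mem_univ _))
  · rw [Finset.sum_eq_zero_iff_of_nonneg fun _ _ => sq_nonneg _] at hN0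
    exact pow_eq_zero_iff two_ne_zero |>.1 (hN0 j (Finset.mem_univ _))
  · have h1 := hRs0 k (Finset.mem_univ _)
    rw [Finset.sum_eq_zero_iff_of_nonneg fun _ _ => Finset.sum_nonneg fun _ _ => sq_nonneg _]
      at h1
    have h2 := h1 y (Finset.mem_univ _)
    rw [Finset.sum_eq_zero_iff_of_nonneg fun _ _ => sq_nonneg _] at h2
    exact pow_eq_zero_iff two_ne_zero |>.1 (h2 y' (Finset.mem_univ _))
  · have h1 := hK' k
    rw [hRs0 k (Finset.mem_univ _), Fintype.sum_option, hJ0] at h1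
    linarith

theorem sum_sum_wedge_mul_wedge {Y : Type*} [Fintype Y] (x a x' a' : Y → ℝ) :
    ∑ y, ∑ y', (x y * a y' - x y' * a y) * (x' y * a' y' - x' y' * a' y)
      = 2 * ((x ⬝ᵥ x') * (a ⬝ᵥ a') - (x ⬝ᵥ a') * (x' ⬝ᵥ a)) := by
  have h : ∀ y y', (x y * a y' - x y' * a y) * (x' y * a' y' - x' y' * a' y)
      = (x y * x' y) * (a y' * a' y') - (x y * a' y) * (x' y' * a y')
        - (x' y * a y) * (x y' * a' y') + (a y * a' y) * (x y' * x' y') := fun y y' => by ring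
  simp only [h, Finset.sum_add_distrib, Finset.sum_sub_distrib, ← Finset.sum_mul_sum, dotProduct]
  ring

theorem dotProduct_relations_of_wedge {K Y : Type*} [Fintype K] [Fintype Y] {N : Y → Y → ℝ}
    {x a : K → Y → ℝ} {μ : ℝ} (hμ : μ ^ 2 = ∑ k, a k ⬝ᵥ a k)
    (hxa : ∀ k, x k ⬝ᵥ x k = a k ⬝ᵥ a k) (hx : ∀ k l, k ≠ l → x k ⬝ᵥ x l = 0)
    (hN : ∀ y y', μ * N y y' = ∑ k, (x k y * a k y' - x k y' * a k y))
    (hNN : ∑ y, ∑ y', N y y' ^ 2 = 2 * μ ^ 2) :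
    (∀ k, x k ⬝ᵥ a k = 0) ∧ ∀ k l, k ≠ l → x l ⬝ᵥ a k = -(x k ⬝ᵥ a l) ∧
      (x k ⬝ᵥ a l) ^ 2 = (a k ⬝ᵥ a k) * (a l ⬝ᵥ a l) := by
  classical
  have hcs : ∀ k l, (x k ⬝ᵥ a l) ^ 2 ≤ (a k ⬝ᵥ a k) * (a l ⬝ᵥ a l) := fun k l => by
    rw [← hxa k]
    simpa only [dotProduct, ← pow_two] using
      Finset.sum_mul_sq_le_sq_mul_sq Finset.univ (x k) (a l)
  have key : ∑ k, ∑ l, ((a k ⬝ᵥ a k) * (a l ⬝ᵥ a l)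
      - ((x k ⬝ᵥ x l) * (a k ⬝ᵥ a l) - (x k ⬝ᵥ a l) * (x l ⬝ᵥ a k))) = 0 := by
    have h1 : ∑ y, ∑ y', (μ * N y y') ^ 2 = 2 * (μ ^ 2 * μ ^ 2) := by
      simp only [mul_pow, ← Finset.mul_sum, hNN]
      ring
    have h2 : ∑ y, ∑ y', (μ * N y y') ^ 2 = ∑ k, ∑ l,
        2 * ((x k ⬝ᵥ x l) * (a k ⬝ᵥ a l) - (x k ⬝ᵥ a l) * (x l ⬝ᵥ a k)) := by
      simp only [← sum_sum_wedge_mul_wedge, hN, pow_two, Finset.sum_mul_sum]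
      simp only [Finset.sum_comm (s := (Finset.univ : Finset Y)) (t := (Finset.univ : Finset K))]
    rw [h1] at h2
    simp only [Finset.sum_sub_distrib, ← hμ, ← Finset.mul_sum, ← Finset.sum_mul] at h2 ⊢
    linarith
  have hterm : ∀ k l, 0 ≤ (a k ⬝ᵥ a k) * (a l ⬝ᵥ a l)
      - ((x k ⬝ᵥ x l) * (a k ⬝ᵥ a l) - (x k ⬝ᵥ a l) * (x l ⬝ᵥ a k)) := fun k l => by
    by_cases h : k = l
    · subst h
      rw [hxa]
      nlinarith [sq_nonneg (x k ⬝ᵥ a k)]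
    · rw [hx k l h]
      nlinarith [hcs k l, hcs l k, sq_nonneg (x k ⬝ᵥ a l + x l ⬝ᵥ a k)]
  rw [Finset.sum_eq_zero_iff_of_nonneg fun k _ => Finset.sum_nonneg fun l _ => hterm k l] at key
  have hz : ∀ k l, (a k ⬝ᵥ a k) * (a l ⬝ᵥ a l)
      - ((x k ⬝ᵥ x l) * (a k ⬝ᵥ a l) - (x k ⬝ᵥ a l) * (x l ⬝ᵥ a k)) = 0 := fun k l =>
    (Finset.sum_eq_zero_iff_of_nonneg fun l _ => hterm k l).1 (key k (Finset.mem_univ _)) l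
      (Finset.mem_univ _)
  refine ⟨fun k => ?_, fun k l hkl => ?_⟩
  · have h := hz k k
    rw [hxa] at h
    exact pow_eq_zero_iff two_ne_zero |>.1 (by linarith : (x k ⬝ᵥ a k) ^ 2 = 0)
  · have h := hz k l
    rw [hx k l hkl] at h
    have hs : (x k ⬝ᵥ a l + x l ⬝ᵥ a k) ^ 2 = 0 := by
      refine le_antisymm ?_ (sq_nonneg _)
      nlinarith [hcs k l, hcs l k]
    have hs' := pow_eq_zero_iff two_ne_zero |>.1 hs
    refine ⟨by linarith, ?_⟩
    have : x l ⬝ᵥ a k = -(x k ⬝ᵥ a l) := by linarith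
    rw [this] at h
    linarith

theorem eq_smul_of_dotProduct_sq_eq {Y : Type*} [Fintype Y] {x a : Y → ℝ} (ha : a ⬝ᵥ a ≠ 0)
    (h : (x ⬝ᵥ a) ^ 2 = (x ⬝ᵥ x) * (a ⬝ᵥ a)) : x = ((x ⬝ᵥ a) / (a ⬝ᵥ a)) • a := by
  rw [← sub_eq_zero, ← dotProduct_self_eq_zero]
  simp only [sub_dotProduct, dotProduct_sub, smul_dotProduct, dotProduct_smul, smul_eq_mul,
    dotProduct_comm a x]
  field_simp
  linear_combination -h

theorem one_or_two_of_dotProduct_relations {K Y : Type*} [Fintype K] [Fintype Y]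
    {x a : K → Y → ℝ} {μ : ℝ} (hμ0 : μ ≠ 0) (hμ : μ ^ 2 = ∑ k, a k ⬝ᵥ a k)
    (ha0 : ∀ k, a k ⬝ᵥ a k ≠ 0)
    (hxa : ∀ k, x k ⬝ᵥ x k = a k ⬝ᵥ a k)
    (ha : ∀ k l, k ≠ l → a k ⬝ᵥ a l = 0)
    (hG : ∀ k l, k ≠ l → (x k ⬝ᵥ a l) ^ 2 = (a k ⬝ᵥ a k) * (a l ⬝ᵥ a l)) :
    (∃ k : K, ∀ l, l = k) ∨ ∃ k l : K, k ≠ l ∧ ∀ m, m = k ∨ m = l := by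
  have hne : ∃ _ : K, True := by
    by_contra! hcon
    have : IsEmpty K := ⟨fun k => hcon k⟩
    simp [hμ0] at hμ
  obtain ⟨k, -⟩ := hne
  by_cases h1 : ∀ l, l = k
  · exact Or.inl ⟨k, h1⟩
  push Not at h1
  obtain ⟨l, hl⟩ := h1
  refine Or.inr ⟨k, l, hl.symm, fun m => ?_⟩
  by_contra! hm
  have e1 := eq_smul_of_dotProduct_sq_eq (ha0 l) (by rw [hxa]; exact hG k l hl.symm)
  have e2 := hG k m hm.1.symm
  rw [e1, smul_dotProduct, ha l m hm.2.symm, smul_zero] at e2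
  simp [ha0] at e2

/-- A frame of a Lorentzian 2-step nilpotent Lie algebra with a cocycle `ω`: the center has the
orthonormal basis `e`, and its orthogonal complement is the orthogonal sum of the line through the
unit vector `f` and of the Euclidean space `Y → ℝ`, embedded by `U`. -/
structure AdaptedFrame {G : Type*} [LieRing G] [LieAlgebra ℝ G] (B ω : G →ₗ[ℝ] G →ₗ[ℝ] ℝ)
    (K Y : Type*) [Fintype K] [Fintype Y] where
  e : Option K → G
  f : G
  U : (Y → ℝ) →ₗ[ℝ] G
  x : K → Y → ℝ
  a : K → Y → ℝ
  μ : ℝ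
  form_e_none : B (e none) (e none) = -1
  form_e_some : ∀ k, B (e (some k)) (e (some k)) = 1
  form_e_ne : ∀ i j, i ≠ j → B (e i) (e j) = 0
  form_f : B f f = 1
  form_e_f : ∀ i, B (e i) f = 0
  form_e_U : ∀ i v, B (e i) (U v) = 0
  form_f_U : ∀ v, B f (U v) = 0
  form_U_U : ∀ v w, B (U v) (U w) = v ⬝ᵥ w
  e_lie : ∀ i (p : G), ⁅e i, p⁆ = 0
  f_lie_U : ∀ v, ⁅f, U v⁆ = ∑ k, (x k ⬝ᵥ v) • e (some k)
  U_lie_U : ∀ v w, ⁅U v, U w⁆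
    = (-μ⁻¹ * ∑ k, ((x k ⬝ᵥ v) * (a k ⬝ᵥ w) - (x k ⬝ᵥ w) * (a k ⬝ᵥ v))) • e none
  ω_e_e : ∀ i j, ω (e i) (e j) = 0
  ω_none_f : ω (e none) f = μ
  ω_some_f : ∀ k, ω (e (some k)) f = 0
  ω_none_U : ∀ v, ω (e none) (U v) = 0
  ω_some_U : ∀ k v, ω (e (some k)) (U v) = a k ⬝ᵥ v
  ω_f_U : ∀ v, ω f (U v) = 0
  ω_U_U : ∀ v w, ω (U v) (U w) = 0
  eq_zero : ∀ p, (∀ i, B p (e i) = 0) → B p f = 0 → (∀ k, B p (U (x k)) = 0) →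
    (∀ k, B p (U (a k)) = 0) → p = 0
  μ_ne_zero : μ ≠ 0
  μ_sq : μ ^ 2 = ∑ k, a k ⬝ᵥ a k
  dot_a_self : ∀ k, a k ⬝ᵥ a k ≠ 0
  dot_x_self : ∀ k, x k ⬝ᵥ x k = a k ⬝ᵥ a k
  dot_x_x : ∀ k l, k ≠ l → x k ⬝ᵥ x l = 0
  dot_a_a : ∀ k l, k ≠ l → a k ⬝ᵥ a l = 0
  dot_x_a_self : ∀ k, x k ⬝ᵥ a k = 0
  dot_x_a_swap : ∀ k l, k ≠ l → x l ⬝ᵥ a k = -(x k ⬝ᵥ a l)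
  dot_x_a_sq : ∀ k l, k ≠ l → (x k ⬝ᵥ a l) ^ 2 = (a k ⬝ᵥ a k) * (a l ⬝ᵥ a l)

section Forms

variable {G : Type*} [LieRing G] [LieAlgebra ℝ G] {B ω : G →ₗ[ℝ] G →ₗ[ℝ] ℝ}
  {K Y : Type*} [Fintype K] [Fintype Y]

theorem AdaptedFrame.exists_basis_five (hsymm : ∀ u v : G, B u v = B v u)
    (A : AdaptedFrame B ω K Y) (k : K) (hk : ∀ l, l = k) :
    ∃ (b : Basis (Fin 5) ℝ G) (α s ε : ℝ),
      (∀ i j, i ≠ j → B (b i) (b j) = 0) ∧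
      B (b 0) (b 0) = -1 ∧ (∀ i, i ≠ 0 → B (b i) (b i) = 1) ∧
      α ≠ 0 ∧ (s = 1 ∨ s = -1) ∧ (ε = 1 ∨ ε = -1) ∧
      ⁅b 2, b 3⁆ = α • b 1 ∧ ⁅b 3, b 4⁆ = (s * α) • b 0 ∧
      (∀ i j : Fin 5, i < j →
        (i, j) ∉ ({(2,3), (3,4)} : Set (Fin 5 × Fin 5)) → ⁅b i, b j⁆ = 0) ∧
      ω (b 1) (b 4) = ε * α ∧ ω (b 0) (b 2) = -(s * ε * α) ∧
      (∀ i j : Fin 5, i < j →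
        (i, j) ∉ ({(1,4), (0,2)} : Set (Fin 5 × Fin 5)) → ω (b i) (b j) = 0) := by
  have hsum : ∀ g : K → ℝ, ∑ l, g l = g k := fun g =>
    Fintype.sum_eq_single k fun l hl => absurd (hk l) hl
  have hsumG : ∀ g : K → G, ∑ l, g l = g k := fun g =>
    Fintype.sum_eq_single k fun l hl => absurd (hk l) hl
  obtain ⟨e, f, U, x, a, μ, hen, hes, hene, hff, hef, heU, hfU, hUU, hel, hfl, hUl, hωee, hωnf,
    hωsf, hωnU, hωsU, hωfU, hωUU, hzero, hμ0, hμ, ha0, hxx, hx, ha, hxa, hsw, hsq⟩ := A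
  rw [hsum] at hμ
  simp only [hsum, hsumG] at hfl hUl
  have hxk := hxx k
  have hxak := hxa k
  set p : Y → ℝ := μ⁻¹ • x k with hp
  set q : Y → ℝ := μ⁻¹ • a k with hq
  have hpp : p ⬝ᵥ p = 1 := by
    rw [hp, smul_dotProduct, dotProduct_smul, hxk, ← hμ, smul_eq_mul, smul_eq_mul]
    field_simp
  have hqq : q ⬝ᵥ q = 1 := by
    rw [hq, smul_dotProduct, dotProduct_smul, ← hμ, smul_eq_mul, smul_eq_mul]
    field_simp
  have hpq : p ⬝ᵥ q = 0 := by simp [hp, hq, hxak]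
  have hqp : q ⬝ᵥ p = 0 := by rw [dotProduct_comm, hpq]
  have hxp : x k ⬝ᵥ p = μ := by
    rw [hp, dotProduct_smul, hxk, ← hμ, smul_eq_mul]
    field_simp
  have haq : a k ⬝ᵥ q = μ := by
    rw [hq, dotProduct_smul, ← hμ, smul_eq_mul]
    field_simp
  have hxq : x k ⬝ᵥ q = 0 := by simp [hq, hxak]
  have hap : a k ⬝ᵥ p = 0 := by simp [hp, dotProduct_comm (a k), hxak]
  have hfe : ∀ i, B f (e i) = 0 := fun i => by rw [hsymm, hef]
  have hUe : ∀ i v, B (U v) (e i) = 0 := fun i v => by rw [hsymm, heU]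
  have hUf : ∀ v, B (U v) f = 0 := fun v => by rw [hsymm, hfU]
  have hns : ∀ l : K, B (e none) (e (some l)) = 0 := fun l => hene _ _ (by simp)
  have hsn : ∀ l : K, B (e (some l)) (e none) = 0 := fun l => hene _ _ (by simp)
  have hv : ∀ i j : Fin 5, B (![e none, e (some k), f, U p, U q] i)
      (![e none, e (some k), f, U p, U q] j) = if i = j then ![-1, 1, 1, 1, 1] i else 0 := by
    intro i j
    fin_cases i <;> fin_cases j <;>
      simp [hen, hes, hff, hef, heU, hfU, hUU, hfe, hUe, hUf, hns, hsn, hpp, hqq, hpq, hqp]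
  obtain ⟨b, hb⟩ := exists_basis_of_orthonormal (σ := ![-1, 1, 1, 1, 1]) _
    (fun i => by fin_cases i <;> simp) hv (fun r hr => by
      refine hzero r (fun i => ?_) (hr 2) (fun l => ?_) (fun l => ?_)
      · rcases i with _ | l
        · exact hr 0
        · rw [hk l]
          exact hr 1
      · have := hr 3
        rw [hk l]
        simpa [hp, hμ0] using this
      · have := hr 4
        rw [hk l]
        simpa [hq, hμ0] using this)
  have hb0 : b 0 = e none := hb 0
  have hb1 : b 1 = e (some k) := hb 1
  have hb2 : b 2 = f := hb 2
  have hb3 : b 3 = U p := hb 3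
  have hb4 : b 4 = U q := hb 4
  refine ⟨b, μ, -1, 1, fun i j hij => ?_, ?_, fun i hi => ?_, hμ0, Or.inr rfl, Or.inl rfl,
    ?_, ?_, fun i j hij hn => ?_, ?_, ?_, fun i j hij hn => ?_⟩
  · rw [hb, hb, hv, if_neg hij]
  · rw [hb0, hen]
  · rw [hb, hv, if_pos rfl]
    fin_cases i <;> simp at hi ⊢
  · rw [hb1, hb2, hb3, hfl, hxp]
  · rw [hb0, hb3, hb4, hUl, hxp, haq, hxq]
    congr 1
    field_simp
    ring
  · fin_cases i <;> fin_cases j <;> simp at hij hn <;>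
      simp [hb0, hb1, hb2, hb3, hb4, hel, hfl, hxq]
  · rw [hb1, hb4, hωsU, haq, one_mul]
  · rw [hb0, hb2, hωnf]
    ring
  · fin_cases i <;> fin_cases j <;> simp at hij hn <;>
      simp [hb0, hb1, hb2, hb3, hb4, hωee, hωsf, hωnU, hωsU, hωfU, hωUU, hap]

theorem AdaptedFrame.exists_basis_six (hsymm : ∀ u v : G, B u v = B v u)
    (A : AdaptedFrame B ω K Y) (k l : K) (hkl : k ≠ l) (hK : ∀ m, m = k ∨ m = l) :
    ∃ (b : Basis (Fin 6) ℝ G) (α₂ α₃ s ε : ℝ),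
      (∀ i j, i ≠ j → B (b i) (b j) = 0) ∧
      B (b 0) (b 0) = -1 ∧ (∀ i, i ≠ 0 → B (b i) (b i) = 1) ∧
      α₂ ≠ 0 ∧ α₃ ≠ 0 ∧ (s = 1 ∨ s = -1) ∧ (ε = 1 ∨ ε = -1) ∧
      ⁅b 3, b 4⁆ = α₂ • b 1 ∧ ⁅b 3, b 5⁆ = α₃ • b 2 ∧
      ⁅b 4, b 5⁆ = (ε * Real.sqrt (α₂ ^ 2 + α₃ ^ 2)) • b 0 ∧
      (∀ i j : Fin 6, i < j →
        (i, j) ∉ ({(3,4), (3,5), (4,5)} : Set (Fin 6 × Fin 6)) → ⁅b i, b j⁆ = 0) ∧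
      ω (b 1) (b 5) = -(s * ε * α₂) ∧ ω (b 2) (b 4) = s * ε * α₃ ∧
      ω (b 0) (b 3) = s * Real.sqrt (α₂ ^ 2 + α₃ ^ 2) ∧
      (∀ i j : Fin 6, i < j →
        (i, j) ∉ ({(1,5), (2,4), (0,3)} : Set (Fin 6 × Fin 6)) → ω (b i) (b j) = 0) := by
  have hsum : ∀ g : K → ℝ, ∑ m, g m = g k + g l := fun g =>
    Fintype.sum_eq_add k l hkl fun m hm => absurd (hK m) (by tauto)
  have hsumG : ∀ g : K → G, ∑ m, g m = g k + g l := fun g =>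
    Fintype.sum_eq_add k l hkl fun m hm => absurd (hK m) (by tauto)
  obtain ⟨e, f, U, x, a, μ, hen, hes, hene, hff, hef, heU, hfU, hUU, hel, hfl, hUl, hωee, hωnf,
    hωsf, hωnU, hωsU, hωfU, hωUU, hzero, hμ0, hμ, ha0, hxx, hx, ha, hxa, hsw, hsq⟩ := A
  rw [hsum] at hμ
  simp only [hsum, hsumG] at hfl hUl
  have hnonneg : ∀ m, 0 ≤ a m ⬝ᵥ a m := fun m =>
    Finset.sum_nonneg fun _ _ => mul_self_nonneg _
  obtain ⟨r, hr0, hr⟩ : ∃ r : K → ℝ, (∀ m, r m ≠ 0) ∧ ∀ m, a m ⬝ᵥ a m = r m ^ 2 :=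
    ⟨fun m => Real.sqrt (a m ⬝ᵥ a m),
      fun m => Real.sqrt_ne_zero'.2 (lt_of_le_of_ne (hnonneg m) (ha0 m).symm),
      fun m => (Real.sq_sqrt (hnonneg m)).symm⟩
  rw [hr, hr] at hμ
  obtain ⟨s, hs, hsμ⟩ : ∃ s : ℝ, (s = 1 ∨ s = -1) ∧ μ = s * Real.sqrt (r k ^ 2 + r l ^ 2) := by
    rw [← hμ, Real.sqrt_sq_eq_abs]
    rcases abs_cases μ with ⟨h, -⟩ | ⟨h, -⟩
    · exact ⟨1, Or.inl rfl, by rw [h]; ring⟩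
    · exact ⟨-1, Or.inr rfl, by rw [h]; ring⟩
  obtain ⟨κ, hκ, hG⟩ : ∃ κ : ℝ, (κ = 1 ∨ κ = -1) ∧ x k ⬝ᵥ a l = κ * (r k * r l) := by
    have h := hsq k l hkl
    rw [hr, hr, ← mul_pow, sq_eq_sq_iff_eq_or_eq_neg] at h
    rcases h with h | h
    · exact ⟨1, Or.inl rfl, by rw [h]; ring⟩
    · exact ⟨-1, Or.inr rfl, by rw [h]; ring⟩
  have hG' := hsw k l hkl
  rw [hG] at hG'
  have hκκ : κ * κ = 1 := by rcases hκ with rfl | rfl <;> norm_num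
  have hss : s * s = 1 := by rcases hs with rfl | rfl <;> norm_num
  set p : Y → ℝ := (r k)⁻¹ • x k with hp
  set q : Y → ℝ := (r l)⁻¹ • x l with hq
  have hrk := hr0 k
  have hrl := hr0 l
  have hpp : p ⬝ᵥ p = 1 := by
    rw [hp, smul_dotProduct, dotProduct_smul, hxx, hr, smul_eq_mul, smul_eq_mul]
    field_simp
  have hqq : q ⬝ᵥ q = 1 := by
    rw [hq, smul_dotProduct, dotProduct_smul, hxx, hr, smul_eq_mul, smul_eq_mul]
    field_simp
  have hpq : p ⬝ᵥ q = 0 := by simp [hp, hq, hx k l hkl]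
  have hqp : q ⬝ᵥ p = 0 := by rw [dotProduct_comm, hpq]
  have hxkp : x k ⬝ᵥ p = r k := by
    rw [hp, dotProduct_smul, hxx, hr, smul_eq_mul]
    field_simp
  have hxlq : x l ⬝ᵥ q = r l := by
    rw [hq, dotProduct_smul, hxx, hr, smul_eq_mul]
    field_simp
  have hxkq : x k ⬝ᵥ q = 0 := by simp [hq, hx k l hkl]
  have hxlp : x l ⬝ᵥ p = 0 := by simp [hp, hx l k hkl.symm]
  have hakp : a k ⬝ᵥ p = 0 := by simp [hp, dotProduct_comm (a k), hxa]
  have halq : a l ⬝ᵥ q = 0 := by simp [hq, dotProduct_comm (a l), hxa]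
  have hakq : a k ⬝ᵥ q = -(κ * r k) := by
    rw [hq, dotProduct_smul, dotProduct_comm (a k), hG', smul_eq_mul]
    field_simp
  have halp : a l ⬝ᵥ p = κ * r l := by
    rw [hp, dotProduct_smul, dotProduct_comm (a l), hG, smul_eq_mul]
    field_simp
  have hfe : ∀ i, B f (e i) = 0 := fun i => by rw [hsymm, hef]
  have hUe : ∀ i v, B (U v) (e i) = 0 := fun i v => by rw [hsymm, heU]
  have hUf : ∀ v, B (U v) f = 0 := fun v => by rw [hsymm, hfU]
  have hns : ∀ m : K, B (e none) (e (some m)) = 0 := fun m => hene _ _ (by simp)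
  have hsn : ∀ m : K, B (e (some m)) (e none) = 0 := fun m => hene _ _ (by simp)
  have hkl' : B (e (some k)) (e (some l)) = 0 := hene _ _ (by simpa using hkl)
  have hlk' : B (e (some l)) (e (some k)) = 0 := hene _ _ (by simpa using hkl.symm)
  have hv : ∀ i j : Fin 6, B (![e none, e (some k), e (some l), f, U p, U q] i)
      (![e none, e (some k), e (some l), f, U p, U q] j)
      = if i = j then ![-1, 1, 1, 1, 1, 1] i else 0 := by
    intro i j
    fin_cases i <;> fin_cases j <;>
      simp [hen, hes, hff, hef, heU, hfU, hUU, hfe, hUe, hUf, hns, hsn, hpp, hqq, hpq, hqp,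
        hkl', hlk']
  obtain ⟨b, hb⟩ := exists_basis_of_orthonormal (σ := ![-1, 1, 1, 1, 1, 1]) _
    (fun i => by fin_cases i <;> simp) hv (fun t ht => by
      have hk4 : B t (U (x k)) = 0 := by simpa [hp, hrk] using ht 4
      have hl5 : B t (U (x l)) = 0 := by simpa [hq, hrl] using ht 5
      have hak : a k = _ • x l := eq_smul_of_dotProduct_sq_eq (by rw [hxx]; exact ha0 l) (by
        rw [dotProduct_comm, hG', hxx, hr, hr]
        linear_combination (r k ^ 2 * r l ^ 2) * hκκ)
      have hal : a l = _ • x k := eq_smul_of_dotProduct_sq_eq (by rw [hxx]; exact ha0 k) (by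
        rw [dotProduct_comm, hG, hxx, hr, hr]
        linear_combination (r k ^ 2 * r l ^ 2) * hκκ)
      refine hzero t (fun i => ?_) (ht 3) (fun m => ?_) (fun m => ?_)
      · rcases i with _ | m
        · exact ht 0
        · rcases hK m with rfl | rfl
          · exact ht 1
          · exact ht 2
      · rcases hK m with rfl | rfl
        · exact hk4
        · exact hl5
      · rcases hK m with rfl | rfl
        · rw [hak, map_smul, map_smul, hl5, smul_zero]
        · rw [hal, map_smul, map_smul, hk4, smul_zero])
  have hb0 : b 0 = e none := hb 0
  have hb1 : b 1 = e (some k) := hb 1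
  have hb2 : b 2 = e (some l) := hb 2
  have hb3 : b 3 = f := hb 3
  have hb4 : b 4 = U p := hb 4
  have hb5 : b 5 = U q := hb 5
  refine ⟨b, r k, r l, s, s * κ, fun i j hij => ?_, ?_, fun i hi => ?_, hrk, hrl, hs, ?_,
    ?_, ?_, ?_, fun i j hij hn => ?_, ?_, ?_, ?_, fun i j hij hn => ?_⟩
  · rw [hb, hb, hv, if_neg hij]
  · rw [hb0, hen]
  · rw [hb, hv, if_pos rfl]
    fin_cases i <;> simp at hi ⊢
  · rcases hs with rfl | rfl <;> rcases hκ with rfl | rfl <;> norm_num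
  · rw [hb1, hb3, hb4, hfl, hxkp, hxlp, zero_smul, add_zero]
  · rw [hb2, hb3, hb5, hfl, hxkq, hxlq, zero_smul, zero_add]
  · rw [hb0, hb4, hb5, hUl, hxkp, hxlp, hxkq, hxlq, hakp, halq, hakq, halp]
    congr 1
    have h1 : s * κ * Real.sqrt (r k ^ 2 + r l ^ 2) = κ * μ := by rw [hsμ]; ring
    rw [h1]
    field_simp
    linear_combination (-κ) * hμ
  · fin_cases i <;> fin_cases j <;> simp at hij hn <;>
      simp [hb0, hb1, hb2, hb3, hb4, hb5, hel]
  · rw [hb1, hb5, hωsU, hakq]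
    linear_combination (κ * r k) * hss
  · rw [hb2, hb4, hωsU, halp]
    linear_combination (-κ * r l) * hss
  · rw [hb0, hb3, hωnf, hsμ]
  · fin_cases i <;> fin_cases j <;> simp at hij hn <;>
      simp [hb0, hb1, hb2, hb3, hb4, hb5, hωee, hωsf, hωnU, hωsU, hωfU, hωUU, hakp, halq]

end Forms

theorem exists_adaptedFrame {G : Type*} [LieRing G] [LieAlgebra ℝ G]
    {K Y : Type*} [Fintype K] [Fintype Y] [DecidableEq K] [DecidableEq Y]
    {B ω : G →ₗ[ℝ] G →ₗ[ℝ] ℝ} {lam : ℝ} (hlam : 0 ≤ lam)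
    (hsymm : ∀ u v : G, B u v = B v u)
    (hωskew : ∀ u v : G, ω u v = -ω v u)
    (hωcocycle : ∀ u v w : G, ω ⁅u, v⁆ w + ω ⁅v, w⁆ u + ω ⁅w, u⁆ v = 0)
    (b : Basis (Option K ⊕ Option Y) ℝ G)
    (hb : ∀ i j, B (b i) (b j) = if i = j then lorentzSign i else 0)
    {e : Option K → G} {u : Option Y → G}
    (he : ∀ k, b (Sum.inl k) = e k) (hu : ∀ i, b (Sum.inr i) = u i)
    (hcenter : ∀ k (p : G), ⁅e k, p⁆ = 0)
    (horth : ∀ z : G, (∀ p : G, ⁅z, p⁆ = 0) → ∀ i, B z (u i) = 0)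
    (hlie : ∀ p q : G, ∀ i, B (u i) ⁅p, q⁆ = 0)
    (hωe : ∀ k l, ω (e k) (e l) = 0)
    (hωe0 : ∀ k, (∀ v, ω (e k) v = 0) → e k = 0)
    (hωorth : ∀ k l, k ≠ l → ∑ i, ω (e k) (u i) * ω (e l) (u i) = 0)
    (hωY : ∀ y, ω (e none) (u (some y)) = 0)
    (hμ0 : ω (e none) (u none) ≠ 0)
    (hRic : ∀ p q : G, -(1/2) * ∑ i, lorentzSign i * B ⁅p, b i⁆ ⁅q, b i⁆
      + (1/4) * ∑ i, ∑ j, lorentzSign i * (lorentzSign j * (B p ⁅b i, b j⁆ * B q ⁅b i, b j⁆))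
      = lam * B p q + (1/2) * ∑ i, lorentzSign i * (ω p (b i) * ω q (b i)))
    (htr : ∑ i, ∑ j, lorentzSign i * (lorentzSign j * (ω (b i) (b j) * ω (b i) (b j)))
      = 4 * lam) :
    lam = 0 ∧ Nonempty (AdaptedFrame B ω K Y) := by
  have hσ := lorentzSign_mul_self (K := K) (Y := Y)
  have hcenter' : ∀ k (p : G), ⁅p, e k⁆ = 0 := fun k p => by
    rw [← lie_skew, hcenter, neg_zero]
  have hωsk : ∀ i k, ω (u i) (e k) = -ω (e k) (u i) := fun i k => hωskew _ _
  have hωf : ∀ k, ω (e (some k)) (u none) = 0 := fun k => by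
    have h := hωorth none (some k) (by simp)
    rw [Fintype.sum_option] at h
    simpa [hωY, hμ0] using h
  have hee : ∀ i j, i ≠ j → B (e i) (e j) = 0 := fun i j h => by
    rw [← he, ← he, hb, if_neg (by simpa using h)]
  have he0 : B (e none) (e none) = -1 := by rw [← he, hb, if_pos rfl, lorentzSign]
  have hek : ∀ k, B (e (some k)) (e (some k)) = 1 := fun k => by
    rw [← he, hb, if_pos rfl, lorentzSign]
  have heu : ∀ i j, B (e i) (u j) = 0 := fun i j => by
    rw [← he, ← hu, hb, if_neg (by simp)]
  have huu : ∀ i j, B (u i) (u j) = if i = j then 1 else 0 := fun i j => by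
    rw [← hu, ← hu, hb]
    simp [lorentzSign]
  have hform : ∀ p q r s : G, B ⁅p, q⁆ ⁅r, s⁆ = -(B (e none) ⁅p, q⁆ * B (e none) ⁅r, s⁆)
      + ∑ k, B (e (some k)) ⁅p, q⁆ * B (e (some k)) ⁅r, s⁆ := fun p q r s => by
    rw [form_eq_sum_of_orthonormal b hσ hb]
    simp only [Fintype.sum_sum_type, Fintype.sum_option, lorentzSign, he, hu, hsymm ⁅_, _⁆, hlie]
    simp
  have hbr : ∀ p q : G, ⁅p, q⁆ = (-B (e none) ⁅p, q⁆) • e none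
      + ∑ k, B (e (some k)) ⁅p, q⁆ • e (some k) := fun p q => by
    conv_lhs => rw [eq_sum_of_orthonormal b hσ hb ⁅p, q⁆]
    simp only [Fintype.sum_sum_type, Fintype.sum_option, lorentzSign, he, hu, hsymm ⁅_, _⁆, hlie]
    simp
  have hRic' : ∀ p q : G, -(1/2) * ∑ i, B ⁅p, u i⁆ ⁅q, u i⁆
      + (1/4) * ∑ i, ∑ j, B p ⁅u i, u j⁆ * B q ⁅u i, u j⁆
      = lam * B p q + (1/2) * (-(ω p (e none) * ω q (e none))
        + ∑ k, ω p (e (some k)) * ω q (e (some k)) + ∑ i, ω p (u i) * ω q (u i)) := fun p q => by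
    have h := hRic p q
    simp only [Fintype.sum_sum_type, Fintype.sum_option (α := K), lorentzSign, he, hu, hcenter,
      hcenter', map_zero, mul_zero, Finset.sum_const_zero,
      zero_add, add_zero, one_mul, neg_mul] at h
    linarith
  have htr' : -(∑ i, ω (e none) (u i) ^ 2) + ∑ k, ∑ i, ω (e (some k)) (u i) ^ 2
      + (1/2) * ∑ i, ∑ j, ω (u i) (u j) ^ 2 = 2 * lam := by
    simp only [Fintype.sum_sum_type, Fintype.sum_option (α := K), lorentzSign, he, hu, hωe, hωsk,
      mul_zero, Finset.sum_const_zero, zero_add, one_mul, neg_mul, mul_neg, neg_neg,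
      Finset.sum_add_distrib, Finset.sum_neg_distrib] at htr
    rw [Finset.sum_comm (s := (Finset.univ : Finset (Option Y)))
      (t := (Finset.univ : Finset K))] at htr
    simp only [pow_two]
    linarith
  have hsum0 : ∑ i, ω (e none) (u i) ^ 2 = ω (e none) (u none) ^ 2 := by
    simp [Fintype.sum_option, hωY]
  have hsumk : ∀ k l, ∑ i, ω (e (some k)) (u i) * ω (e (some l)) (u i)
      = ∑ y, ω (e (some k)) (u (some y)) * ω (e (some l)) (u (some y)) := fun k l => by
    simp [Fintype.sum_option, hωf]
  have hRice : ∀ i j, ∑ p, ∑ q, B (e i) ⁅u p, u q⁆ * B (e j) ⁅u p, u q⁆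
      = 4 * lam * B (e i) (e j) + 2 * ∑ p, ω (e i) (u p) * ω (e j) (u p) := fun i j => by
    have h := hRic' (e i) (e j)
    simp only [hcenter, hωe, map_zero, Finset.sum_const_zero, mul_zero, neg_zero, zero_add] at h
    linarith
  have hRicu : ∀ i, ∑ m, B (e none) ⁅u i, u m⁆ ^ 2 - ∑ k, ∑ m, B (e (some k)) ⁅u i, u m⁆ ^ 2
      = 2 * lam - ω (e none) (u i) ^ 2 + ∑ k, ω (e (some k)) (u i) ^ 2
        + ∑ m, ω (u i) (u m) ^ 2 := fun i => by
    have h := hRic' (u i) (u i)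
    simp only [hform, hlie, huu, if_true, hωsk, mul_one, Finset.sum_add_distrib,
      Finset.sum_neg_distrib, ← pow_two, neg_sq, zero_pow two_ne_zero, Finset.sum_const_zero] at h
    rw [Finset.sum_comm (s := (Finset.univ : Finset (Option Y)))
      (t := (Finset.univ : Finset K))] at h
    linarith
  have hF0 : ∀ j, ω (u none) (u j) = 0 := fun j => by
    have h := hRic' (e none) (u j)
    rw [Fintype.sum_option (f := fun i => ω _ _ * ω _ _)] at h
    simp only [hcenter, hωe, heu, hlie, hωY, map_zero, LinearMap.zero_apply, zero_mul, mul_zero,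
      Finset.sum_const_zero, neg_zero, zero_add, add_zero] at h
    rw [hωskew (u j)] at h
    simpa [hμ0] using h
  obtain ⟨hl0, hF, hJ0, hJ, hμ, hxa⟩ := einstein_constant_eq_zero
    (J₀ := fun i j => B (e none) ⁅u i, u j⁆) (F := fun i j => ω (u i) (u j))
    (J := fun k i j => B (e (some k)) ⁅u i, u j⁆) (a := fun k y => ω (e (some k)) (u (some y)))
    (μ := ω (e none) (u none)) hlam
    (fun k i j => by rw [← lie_skew, map_neg])
    (by
      have h := hRice none none
      simp only [he0, ← pow_two, hsum0] at h
      linarith)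
    (fun k => by
      have h := hRice (some k) (some k)
      rw [hsumk] at h
      simp only [hek, ← pow_two] at h
      linarith)
    (by simpa [-Fintype.sum_option, hωf, hF0] using hRicu none)
    (fun y => by simpa [-Fintype.sum_option, hωY] using hRicu (some y))
    hF0
    (by
      have h := htr'
      simp only [pow_two, hsumk] at h
      simp only [← pow_two, hsum0] at h
      exact h)
  refine ⟨hl0, ?_⟩
  have hJs : ∀ k y, B (e (some k)) ⁅u (some y), u none⁆ = -B (e (some k)) ⁅u none, u (some y)⁆ :=
    fun k y => by rw [← lie_skew, map_neg]
  have hJself : ∀ i j, B (e i) ⁅u j, u j⁆ = 0 := fun i j => by rw [lie_self, map_zero]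
  have hJ0' : ∀ y, B (e none) ⁅u y, u none⁆ = 0 := fun y => by
    rw [← lie_skew, map_neg, hJ0, neg_zero]
  set x : K → Y → ℝ := fun k y => B (e (some k)) ⁅u none, u (some y)⁆ with hx
  set a : K → Y → ℝ := fun k y => ω (e (some k)) (u (some y)) with ha
  set μ := ω (e none) (u none) with hμd
  set N : Y → Y → ℝ := fun y y' => B (e none) ⁅u (some y), u (some y')⁆ with hNd
  have hxx : ∀ k l, k ≠ l → x k ⬝ᵥ x l = 0 := fun k l hkl => by
    have h := hRice (some k) (some l)
    rw [hee _ _ (by simpa using hkl), hωorth _ _ (by simpa using hkl)] at h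
    simp only [Fintype.sum_option, hJ, hJs, hJself, neg_mul_neg, mul_zero, Finset.sum_const_zero,
      add_zero, zero_add] at h
    simp only [dotProduct, hx]
    linarith
  have haa : ∀ k l, k ≠ l → a k ⬝ᵥ a l = 0 := fun k l hkl => by
    have h := hωorth (some k) (some l) (by simpa using hkl)
    rwa [hsumk] at h
  have hN : ∀ y y', μ * N y y' = ∑ k, (x k y * a k y' - x k y' * a k y) := fun y y' => by
    have h := hωcocycle (u none) (u (some y)) (u (some y'))
    rw [hbr (u none), hbr (u (some y)), hbr (u (some y'))] at h
    simp only [map_add, map_smul, map_sum, LinearMap.add_apply, LinearMap.smul_apply,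
      LinearMap.sum_apply, smul_eq_mul, hωY, hωf, hJ0, hJ0', hJs, mul_zero, neg_zero, zero_add,
      Finset.sum_const_zero, add_zero, neg_mul, Finset.sum_neg_distrib] at h
    rw [Finset.sum_sub_distrib]
    simp only [hx, ha, hNd, hμd]
    linarith
  have hNN : ∑ y, ∑ y', N y y' ^ 2 = 2 * μ ^ 2 := by
    have h := hRice none none
    simp only [← pow_two, hsum0, hl0, Fintype.sum_option (α := Y), hJ0, hJ0'] at h
    simpa using h
  have hμ' : μ ^ 2 = ∑ k, a k ⬝ᵥ a k := by
    rw [hμ]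
    simp only [dotProduct, pow_two, ha]
  have hxa' : ∀ k, x k ⬝ᵥ x k = a k ⬝ᵥ a k := fun k => by
    simpa only [dotProduct, ← pow_two] using hxa k
  obtain ⟨hxak, hxakl⟩ := dotProduct_relations_of_wedge hμ' hxa' hxx hN hNN
  let U : (Y → ℝ) →ₗ[ℝ] G := Fintype.linearCombination ℝ fun y => u (some y)
  have hU : ∀ v, U v = ∑ y, v y • u (some y) := fun v => Fintype.linearCombination_apply ℝ _ v
  have heU : ∀ i v, B (e i) (U v) = 0 := fun i v => by simp [hU, heu]
  have hfU : ∀ v, B (u none) (U v) = 0 := fun v => by simp [hU, huu]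
  have hUU : ∀ v w, B (U v) (U w) = v ⬝ᵥ w := fun v w => by simp [hU, huu, dotProduct, mul_comm]
  have hfl : ∀ v, ⁅u none, U v⁆ = ∑ k, (x k ⬝ᵥ v) • e (some k) := fun v => by
    rw [hbr]
    simp [hU, hJ0, hx, dotProduct, mul_comm, lie_sum]
  have hωsU : ∀ k v, ω (e (some k)) (U v) = a k ⬝ᵥ v := fun k v => by
    simp [hU, ha, dotProduct, mul_comm]
  have hUl : ∀ v w, ⁅U v, U w⁆ = (-μ⁻¹ * ∑ k, ((x k ⬝ᵥ v) * (a k ⬝ᵥ w)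
      - (x k ⬝ᵥ w) * (a k ⬝ᵥ v))) • e none := fun v w => by
    have h0 : ∀ k, B (e (some k)) ⁅U v, U w⁆ = 0 := fun k => by
      simp [hU, lie_sum, sum_lie, hJ]
    have h1 := hωcocycle (u none) (U v) (U w)
    have h2 := hbr (U v) (U w)
    simp only [h0, zero_smul, Finset.sum_const_zero, add_zero] at h2
    rw [← lie_skew (U w), hfl, hfl, h2] at h1
    simp only [map_smul, map_sum, map_neg, LinearMap.neg_apply, LinearMap.smul_apply,
      LinearMap.sum_apply, smul_eq_mul, hωsU] at h1
    rw [← hμd] at h1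
    rw [h2, Finset.sum_sub_distrib]
    congr 1
    field_simp
    linarith
  have hexp : ∀ p, ∃ (c : Option K → ℝ) (t : ℝ), p = ∑ i, c i • e i + t • u none
      + U fun y => B p (u (some y)) := fun p => by
    refine ⟨fun i => lorentzSign (Y := Y) (Sum.inl i) * B p (e i), B p (u none), ?_⟩
    conv_lhs => rw [eq_sum_of_orthonormal b hσ hb p]
    rw [Fintype.sum_sum_type, Fintype.sum_option (α := Y)]
    simp only [he, hu, lorentzSign, one_mul, hU, add_assoc]
  refine ⟨⟨e, u none, U, x, a, μ, he0, hek, hee, by simp [huu], fun i => heu i _, heU, hfU, hUU,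
    hcenter, hfl, hUl, hωe, rfl, hωf, fun v => by simp [hU, hωY], hωsU, fun v => by simp [hU, hF],
    fun v w => by simp [hU, hF], ?_, hμ0, hμ', ?_, hxa', hxx, haa, hxak,
    fun k l h => (hxakl k l h).1, fun k l h => (hxakl k l h).2⟩⟩
  · intro p hpe hpu hpx hpa
    have hpU : p = U fun y => B p (u (some y)) := by
      conv_lhs => rw [eq_sum_of_orthonormal b hσ hb p]
      rw [Fintype.sum_sum_type, Fintype.sum_option (α := Y)]
      simp [he, hu, lorentzSign, hU, hpe, hpu]
    generalize (fun y => B p (u (some y))) = v at hpU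
    subst hpU
    simp only [hUU, dotProduct_comm v] at hpx hpa
    have hv : ∀ w, ⁅U v, U w⁆ = 0 := fun w => by simp [hUl, hpx, hpa]
    have hvf : ⁅U v, u none⁆ = 0 := by rw [← lie_skew, hfl]; simp [hpx]
    have hcen := horth (U v) fun q => by
      obtain ⟨c, t, hq⟩ := hexp q
      rw [hq]
      simp [lie_sum, hcenter', hv, hvf]
    rw [eq_sum_of_orthonormal b hσ hb (U v), Fintype.sum_sum_type]
    simp [-Fintype.sum_option, he, hu, hpe, hcen]
  · intro k h
    rw [dotProduct_self_eq_zero] at h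
    have h0 := hωe0 (some k) fun q => by
      obtain ⟨c, t, hq⟩ := hexp q
      rw [hq]
      simp [hωe, hωf, hωsU, h]
    have := hek k
    rw [h0] at this
    simp at this

theorem form_eq_ite_of_orthonormal {G : Type*} [AddCommGroup G] [Module ℝ G]
    {B : G →ₗ[ℝ] G →ₗ[ℝ] ℝ} {n : ℕ} {b : Fin (n + 1) → G}
    (horth : ∀ i j, i ≠ j → B (b i) (b j) = 0) (h0 : B (b 0) (b 0) = -1)
    (h1 : ∀ i, i ≠ 0 → B (b i) (b i) = 1) (i j : Fin (n + 1)) :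
    B (b i) (b j) = if i = j then (if i = 0 then -1 else 1) else 0 := by
  split_ifs with h h'
  · subst h h'
    exact h0
  · subst h
    exact h1 i h'
  · exact horth i j h

theorem form_eq_zero_of_trichotomy {M N : Type*} [AddCommGroup N] {f : M → M → N}
    (hf : ∀ u v, f u v = -f v u) (hf0 : ∀ u, f u u = 0) {n : ℕ} {b : Fin n → M}
    {s : Set (Fin n × Fin n)} (h : ∀ i j, i < j → (i, j) ∉ s → f (b i) (b j) = 0)
    (i j : Fin n) (hij : (i, j) ∉ s) (hji : (j, i) ∉ s) : f (b i) (b j) = 0 := by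
  rcases lt_trichotomy i j with hlt | rfl | hlt
  · exact h i j hlt hij
  · exact hf0 _
  · rw [hf, h j i hlt hji, neg_zero]

section QuasiEinstein

variable {G : Type*} [LieRing G] [LieAlgebra ℝ G] [Module.Finite ℝ G]
  {B ω : G →ₗ[ℝ] G →ₗ[ℝ] ℝ} (hωskew : ∀ u v : G, ω u v = -ω v u)
  {S : Module.End ℝ G} (hS : ∀ u v : G, B (S u) v = ω u v)
  {adStar : G → Module.End ℝ G} (hadStar : ∀ u v w : G, B (adStar u v) w = B v ⁅u, w⁆)
  {Jm : G → Module.End ℝ G} (hJm : ∀ u v w : G, B (Jm u v) w = B u ⁅v, w⁆)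

include hωskew hS hadStar hJm

theorem quasiEinstein_five (b : Basis (Fin 5) ℝ G) {α s ε : ℝ}
    (horth : ∀ i j, i ≠ j → B (b i) (b j) = 0)
    (h0 : B (b 0) (b 0) = -1) (h1 : ∀ i, i ≠ 0 → B (b i) (b i) = 1)
    (hα : α ≠ 0) (hs : s = 1 ∨ s = -1) (hε : ε = 1 ∨ ε = -1)
    (h23 : ⁅b 2, b 3⁆ = α • b 1) (h34 : ⁅b 3, b 4⁆ = (s * α) • b 0)
    (hlie : ∀ i j : Fin 5, i < j →
      (i, j) ∉ ({(2,3), (3,4)} : Set (Fin 5 × Fin 5)) → ⁅b i, b j⁆ = 0)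
    (h14 : ω (b 1) (b 4) = ε * α) (h02 : ω (b 0) (b 2) = -(s * ε * α))
    (hω : ∀ i j : Fin 5, i < j →
      (i, j) ∉ ({(1,4), (0,2)} : Set (Fin 5 × Fin 5)) → ω (b i) (b j) = 0) :
    (∀ u : G, (∀ v : G, ω u v = 0) → u ∈ LieAlgebra.center ℝ G → u = 0) ∧
    (∀ u v : G,
      -(1/2) * LinearMap.trace ℝ G ((LieAlgebra.ad ℝ G u : Module.End ℝ G) ∘ₗ adStar v)
        - (1/4) * LinearMap.trace ℝ G (Jm u ∘ₗ Jm v)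
      = 0 * B u v + (1/2) * B (-(S (S u))) v) ∧
    LinearMap.trace ℝ G (S ∘ₗ S) = -4 * 0 := by
  set σ : Fin 5 → ℝ := fun i => if i = 0 then -1 else 1 with hσd
  have hσ : ∀ i, σ i * σ i = 1 := fun i => by
    simp only [hσd]
    split_ifs <;> norm_num
  have hb := form_eq_ite_of_orthonormal horth h0 h1
  have hs0 : s ≠ 0 := by rcases hs with rfl | rfl <;> norm_num
  have hε0 : ε ≠ 0 := by rcases hε with rfl | rfl <;> norm_num
  have hL := form_eq_zero_of_trichotomy (f := fun u v : G => ⁅u, v⁆)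
    (fun u v => (lie_skew u v).symm) lie_self hlie
  have hW := form_eq_zero_of_trichotomy (f := fun u v : G => ω u v) hωskew
    (fun u => by linarith [hωskew u u]) hω
  have h32 : ⁅b 3, b 2⁆ = (-α) • b 1 := by rw [← lie_skew, h23, neg_smul]
  have h43 : ⁅b 4, b 3⁆ = (-(s * α)) • b 0 := by rw [← lie_skew, h34, neg_smul]
  have h41 : ω (b 4) (b 1) = -(ε * α) := by rw [hωskew, h14]
  have h20 : ω (b 2) (b 0) = s * ε * α := by rw [hωskew, h02, neg_neg]
  have hlb : ∀ i j : Fin 5, ⁅b i, b j⁆ = (!![0,0,0,0,0;0,0,0,0,0;0,0,0,0,0;0,0,0,0,s*α;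
      0,0,0,-(s*α),0] i j) • b 0
      + (!![0,0,0,0,0;0,0,0,0,0;0,0,0,α,0;0,0,-α,0,0;0,0,0,0,0] i j) • b 1 := by
    intro i j
    fin_cases i <;> fin_cases j <;> simp [h23, h32, h34, h43] <;> exact hL _ _ (by simp) (by simp)
  have hωb : ∀ i j : Fin 5, ω (b i) (b j) = !![0,0,-(s*ε*α),0,0;0,0,0,0,ε*α;s*ε*α,0,0,0,0;
      0,0,0,0,0;0,-(ε*α),0,0,0] i j := by
    intro i j
    fin_cases i <;> fin_cases j <;> simp [h14, h41, h02, h20] <;> exact hW _ _ (by simp) (by simp)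
  have hexp : ∀ p : G, ∃ P0 P1 P2 P3 P4 : ℝ,
      p = P0 • b 0 + P1 • b 1 + P2 • b 2 + P3 • b 3 + P4 • b 4 := fun p =>
    ⟨_, _, _, _, _, by rw [← Fin.sum_univ_five fun i => _ • b i]; exact (b.sum_repr p).symm⟩
  refine ⟨?_, fun p q => ?_, ?_⟩
  · intro p hp hpc
    rw [LieModule.mem_maxTrivSubmodule] at hpc
    obtain ⟨P0, P1, P2, P3, P4, rfl⟩ := hexp p
    have k0 := hp (b 0)
    have k1 := hp (b 1)
    have k2 := hp (b 2)
    have k4 := hp (b 4)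
    have k3 := congrArg (fun z => B z (b 1)) (hpc (b 2))
    simp [hωb, hlb, hb, hα, hs0, hε0] at k0 k1 k2 k3 k4
    simp [k0, k1, k2, k3, k4]
  · rw [trace_ad_comp_adjoint b hσ hb hadStar, trace_J_comp_J b hσ hb hJm,
      form_skew_sq b hσ hb hωskew hS]
    obtain ⟨P0, P1, P2, P3, P4, rfl⟩ := hexp p
    obtain ⟨Q0, Q1, Q2, Q3, Q4, rfl⟩ := hexp q
    simp [Fin.sum_univ_five, hlb, hωb, hb, hσd]
    rcases hs with rfl | rfl <;> rcases hε with rfl | rfl <;> ring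
  · rw [trace_skew_sq b hσ hb hωskew hS]
    simp [Fin.sum_univ_five, hωb, hσd]
    rcases hs with rfl | rfl <;> ring

theorem quasiEinstein_six (b : Basis (Fin 6) ℝ G) {α₂ α₃ r s ε : ℝ}
    (horth : ∀ i j, i ≠ j → B (b i) (b j) = 0)
    (h0 : B (b 0) (b 0) = -1) (h1 : ∀ i, i ≠ 0 → B (b i) (b i) = 1)
    (hα₂ : α₂ ≠ 0) (hα₃ : α₃ ≠ 0) (hs : s = 1 ∨ s = -1) (hε : ε = 1 ∨ ε = -1)
    (hr : r ^ 2 = α₂ ^ 2 + α₃ ^ 2)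
    (h34 : ⁅b 3, b 4⁆ = α₂ • b 1) (h35 : ⁅b 3, b 5⁆ = α₃ • b 2) (h45 : ⁅b 4, b 5⁆ = (ε * r) • b 0)
    (hlie : ∀ i j : Fin 6, i < j →
      (i, j) ∉ ({(3,4), (3,5), (4,5)} : Set (Fin 6 × Fin 6)) → ⁅b i, b j⁆ = 0)
    (h15 : ω (b 1) (b 5) = -(s * ε * α₂)) (h24 : ω (b 2) (b 4) = s * ε * α₃)
    (h03 : ω (b 0) (b 3) = s * r)
    (hω : ∀ i j : Fin 6, i < j →
      (i, j) ∉ ({(1,5), (2,4), (0,3)} : Set (Fin 6 × Fin 6)) → ω (b i) (b j) = 0) :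
    (∀ u : G, (∀ v : G, ω u v = 0) → u ∈ LieAlgebra.center ℝ G → u = 0) ∧
    (∀ u v : G,
      -(1/2) * LinearMap.trace ℝ G ((LieAlgebra.ad ℝ G u : Module.End ℝ G) ∘ₗ adStar v)
        - (1/4) * LinearMap.trace ℝ G (Jm u ∘ₗ Jm v)
      = 0 * B u v + (1/2) * B (-(S (S u))) v) ∧
    LinearMap.trace ℝ G (S ∘ₗ S) = -4 * 0 := by
  set σ : Fin 6 → ℝ := fun i => if i = 0 then -1 else 1 with hσd
  have hσ : ∀ i, σ i * σ i = 1 := fun i => by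
    simp only [hσd]
    split_ifs <;> norm_num
  have hb := form_eq_ite_of_orthonormal horth h0 h1
  have hs0 : s ≠ 0 := by rcases hs with rfl | rfl <;> norm_num
  have hε0 : ε ≠ 0 := by rcases hε with rfl | rfl <;> norm_num
  have hr0 : r ≠ 0 := by
    rintro rfl
    have := pow_pos (abs_pos.2 hα₂) 2
    rw [sq_abs] at this
    linarith [sq_nonneg α₃]
  have hL := form_eq_zero_of_trichotomy (f := fun u v : G => ⁅u, v⁆)
    (fun u v => (lie_skew u v).symm) lie_self hlie
  have hW := form_eq_zero_of_trichotomy (f := fun u v : G => ω u v) hωskew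
    (fun u => by linarith [hωskew u u]) hω
  have h43 : ⁅b 4, b 3⁆ = (-α₂) • b 1 := by rw [← lie_skew, h34, neg_smul]
  have h53 : ⁅b 5, b 3⁆ = (-α₃) • b 2 := by rw [← lie_skew, h35, neg_smul]
  have h54 : ⁅b 5, b 4⁆ = (-(ε * r)) • b 0 := by rw [← lie_skew, h45, neg_smul]
  have h51 : ω (b 5) (b 1) = s * ε * α₂ := by rw [hωskew, h15, neg_neg]
  have h42 : ω (b 4) (b 2) = -(s * ε * α₃) := by rw [hωskew, h24]
  have h30 : ω (b 3) (b 0) = -(s * r) := by rw [hωskew, h03]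
  have hlb : ∀ i j : Fin 6, ⁅b i, b j⁆
      = (!![0,0,0,0,0,0;0,0,0,0,0,0;0,0,0,0,0,0;0,0,0,0,0,0;0,0,0,0,0,ε*r;
        0,0,0,0,-(ε*r),0] i j) • b 0
      + (!![0,0,0,0,0,0;0,0,0,0,0,0;0,0,0,0,0,0;0,0,0,0,α₂,0;0,0,0,-α₂,0,0;0,0,0,0,0,0] i j) • b 1
      + (!![0,0,0,0,0,0;0,0,0,0,0,0;0,0,0,0,0,0;0,0,0,0,0,α₃;0,0,0,0,0,0;
        0,0,0,-α₃,0,0] i j) • b 2 := by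
    intro i j
    fin_cases i <;> fin_cases j <;> simp [h34, h43, h35, h53, h45, h54] <;>
      exact hL _ _ (by simp) (by simp)
  have hωb : ∀ i j : Fin 6, ω (b i) (b j) = !![0,0,0,s*r,0,0;0,0,0,0,0,-(s*ε*α₂);
      0,0,0,0,s*ε*α₃,0;-(s*r),0,0,0,0,0;0,0,-(s*ε*α₃),0,0,0;0,s*ε*α₂,0,0,0,0] i j := by
    intro i j
    fin_cases i <;> fin_cases j <;> simp [h15, h51, h24, h42, h03, h30] <;>
      exact hW _ _ (by simp) (by simp)
  have hexp : ∀ p : G, ∃ P0 P1 P2 P3 P4 P5 : ℝ, p = P0 • b 0 + P1 • b 1 + P2 • b 2 + P3 • b 3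
      + P4 • b 4 + P5 • b 5 := fun p => ⟨_, _, _, _, _, _, by
    rw [← Fin.sum_univ_six fun i => _ • b i]
    exact (b.sum_repr p).symm⟩
  refine ⟨?_, fun p q => ?_, ?_⟩
  · intro p hp _
    obtain ⟨P0, P1, P2, P3, P4, P5, rfl⟩ := hexp p
    have k0 := hp (b 0)
    have k1 := hp (b 1)
    have k2 := hp (b 2)
    have k3 := hp (b 3)
    have k4 := hp (b 4)
    have k5 := hp (b 5)
    simp [hωb, hα₂, hα₃, hr0, hs0, hε0] at k0 k1 k2 k3 k4 k5
    simp [k0, k1, k2, k3, k4, k5]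
  · rw [trace_ad_comp_adjoint b hσ hb hadStar, trace_J_comp_J b hσ hb hJm,
      form_skew_sq b hσ hb hωskew hS]
    obtain ⟨P0, P1, P2, P3, P4, P5, rfl⟩ := hexp p
    obtain ⟨Q0, Q1, Q2, Q3, Q4, Q5, rfl⟩ := hexp q
    simp [Fin.sum_univ_six, hlb, hωb, hb, hσd]
    rcases hs with rfl | rfl <;> rcases hε with rfl | rfl <;>
      linear_combination (1/2 * (P3 * Q3 + P4 * Q4 + P5 * Q5)) * hr
  · rw [trace_skew_sq b hσ hb hωskew hS]
    simp [Fin.sum_univ_six, hωb, hσd]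
    rcases hs with rfl | rfl <;> rcases hε with rfl | rfl <;> linear_combination (2 * hr)

end QuasiEinstein

/-- Let `(g,[·,·],⟨·,·⟩)` be a Lorentzian 2-step nilpotent Lie algebra with
`Z(g) = [g,g]` nondegenerate Lorentzian, and `ω` a 2-cocycle on `g`.  For `λ ≥ 0`, `g` is
`ω`-quasi Einstein of type 1 with Einstein constant `λ` iff `λ = 0` and, up to isomorphism,
`(g,[·,·],⟨·,·⟩,ω)` is one of the two explicit structures of dimension 5 and 6. -/
theorem statement13
    {G : Type*} [LieRing G] [LieAlgebra ℝ G] [Module.Finite ℝ G]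
    (B : G →ₗ[ℝ] G →ₗ[ℝ] ℝ)
    (hsymm : ∀ u v : G, B u v = B v u)
    (hnd : ∀ u : G, (∀ v : G, B u v = 0) → u = 0)
    (hLor : IsLorentzianForm B)
    -- `g` is 2-step nilpotent
    (h2step : (∀ u v w : G, ⁅⁅u, v⁆, w⁆ = 0) ∧ ∃ u v : G, ⁅u, v⁆ ≠ 0)
    -- `Z(g) = [g,g]` ...
    (hZder : (LieAlgebra.center ℝ G).toSubmodule = derivedSubmodule G)
    -- ... is nondegenerate of signature `(1, dim[g,g] − 1)`
    (hderLor : ∃ (m : ℕ) (c : Basis (Fin (m + 1)) ℝ (derivedSubmodule G)),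
      (∀ i j, i ≠ j → B (c i : G) (c j : G) = 0) ∧
      B (c 0 : G) (c 0 : G) = -1 ∧ ∀ i, i ≠ 0 → B (c i : G) (c i : G) = 1)
    -- `ω` is a (skew-symmetric) 2-cocycle with values in `ℝ`
    (ω : G →ₗ[ℝ] G →ₗ[ℝ] ℝ)
    (hωskew : ∀ u v : G, ω u v = - ω v u)
    (hωcocycle : ∀ u v w : G, ω ⁅u, v⁆ w + ω ⁅v, w⁆ u + ω ⁅w, u⁆ v = 0)
    -- `S` is the skew-symmetric endomorphism with `ω(u,v) = ⟨Su,v⟩`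
    (S : Module.End ℝ G)
    (hS : ∀ u v : G, B (S u) v = ω u v)
    -- `adStar u` is the adjoint of `ad u` with respect to `B`
    (adStar : G → Module.End ℝ G)
    (hadStar : ∀ u v w : G, B (adStar u v) w = B v ⁅u, w⁆)
    -- `Jm u` is the skew-symmetric endomorphism `J_u(v) = ad_v*(u)`
    (Jm : G → Module.End ℝ G)
    (hJm : ∀ u v w : G, B (Jm u v) w = B u ⁅v, w⁆)
    (lam : ℝ) (hlam : 0 ≤ lam) :
    -- `g` is `ω`-quasi Einstein of type 1 with Einstein constant `λ` ...
    ((∀ u : G, (∀ v : G, ω u v = 0) → u ∈ LieAlgebra.center ℝ G → u = 0) ∧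
     (∀ u v : G,
        -(1/2) * LinearMap.trace ℝ G ((LieAlgebra.ad ℝ G u : Module.End ℝ G) ∘ₗ adStar v)
          - (1/4) * LinearMap.trace ℝ G (Jm u ∘ₗ Jm v)
        = lam * B u v + (1/2) * B (-(S (S u))) v) ∧
     LinearMap.trace ℝ G (S ∘ₗ S) = -4 * lam)
    ↔
    -- ... iff `λ = 0` and `(g,[·,·],⟨·,·⟩,ω)` has one of the following two forms
    (lam = 0 ∧
      -- (1) `dim g = 5`, orthonormal basis `{e₁,e₂,u₁,u₂,u₃} = {b 0, b 1, b 2, b 3, b 4}`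
      ((∃ (b : Basis (Fin 5) ℝ G) (α s ε : ℝ),
          (∀ i j, i ≠ j → B (b i) (b j) = 0) ∧
          B (b 0) (b 0) = -1 ∧ (∀ i, i ≠ 0 → B (b i) (b i) = 1) ∧
          α ≠ 0 ∧ (s = 1 ∨ s = -1) ∧ (ε = 1 ∨ ε = -1) ∧
          ⁅b 2, b 3⁆ = α • b 1 ∧ ⁅b 3, b 4⁆ = (s * α) • b 0 ∧
          (∀ i j : Fin 5, i < j →
            (i, j) ∉ ({(2,3), (3,4)} : Set (Fin 5 × Fin 5)) → ⁅b i, b j⁆ = 0) ∧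
          ω (b 1) (b 4) = ε * α ∧ ω (b 0) (b 2) = -(s * ε * α) ∧
          (∀ i j : Fin 5, i < j →
            (i, j) ∉ ({(1,4), (0,2)} : Set (Fin 5 × Fin 5)) → ω (b i) (b j) = 0)) ∨
      -- (2) `dim g = 6`, orthonormal basis `{e₁,e₂,e₃,u₁,u₂,u₃} = {b 0, …, b 5}`
        (∃ (b : Basis (Fin 6) ℝ G) (α₂ α₃ s ε : ℝ),
          (∀ i j, i ≠ j → B (b i) (b j) = 0) ∧
          B (b 0) (b 0) = -1 ∧ (∀ i, i ≠ 0 → B (b i) (b i) = 1) ∧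
          α₂ ≠ 0 ∧ α₃ ≠ 0 ∧ (s = 1 ∨ s = -1) ∧ (ε = 1 ∨ ε = -1) ∧
          ⁅b 3, b 4⁆ = α₂ • b 1 ∧ ⁅b 3, b 5⁆ = α₃ • b 2 ∧
          ⁅b 4, b 5⁆ = (ε * Real.sqrt (α₂ ^ 2 + α₃ ^ 2)) • b 0 ∧
          (∀ i j : Fin 6, i < j →
            (i, j) ∉ ({(3,4), (3,5), (4,5)} : Set (Fin 6 × Fin 6)) → ⁅b i, b j⁆ = 0) ∧
          ω (b 1) (b 5) = -(s * ε * α₂) ∧ ω (b 2) (b 4) = s * ε * α₃ ∧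
          ω (b 0) (b 3) = s * Real.sqrt (α₂ ^ 2 + α₃ ^ 2) ∧
          (∀ i j : Fin 6, i < j →
            (i, j) ∉ ({(1,5), (2,4), (0,3)} : Set (Fin 6 × Fin 6)) → ω (b i) (b j) = 0)))) := by
  have hcen : ∀ {z : G}, z ∈ derivedSubmodule G ↔ ∀ p : G, ⁅z, p⁆ = 0 := fun {z} => by
    rw [← hZder, LieSubmodule.mem_toSubmodule, LieModule.mem_maxTrivSubmodule]
    refine forall_congr' fun p => ?_
    rw [← lie_skew, neg_eq_zero]
  have hmem : ∀ p q : G, ⁅p, q⁆ ∈ derivedSubmodule G :=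
    fun p q => Submodule.subset_span ⟨p, q, rfl⟩
  constructor
  · rintro ⟨hker, hRic, htr⟩
    have hωW : ∀ z ∈ derivedSubmodule G, ∀ w ∈ derivedSubmodule G, ω z w = 0 := by
      intro z hz w hw
      have hw' := hcen.1 hw
      refine Submodule.span_induction ?_ (by simp) (fun x y _ _ hx hy => by simp [hx, hy])
        (fun r x _ hx => by simp [hx]) hz
      rintro _ ⟨p, q, rfl⟩
      have h := hωcocycle p q w
      rw [← lie_skew q w] at h
      simpa [hw'] using h
    have hker' : ∀ z ∈ derivedSubmodule G, (∀ v, ω z v = 0) → z = 0 := fun z hz h =>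
      hker z h (by rwa [← LieSubmodule.mem_toSubmodule, hZder])
    obtain ⟨m, c, -, hc0, -⟩ := hderLor
    obtain ⟨K, Y, _, _, _, _, b, hb, hbW, hbo, hSo, hSY, hSμ⟩ :=
      exists_adapted_basis hsymm hLor (derivedSubmodule G) (c 0).2 (by rw [hc0]; norm_num) S
        (fun z hz w hw => by rw [hS, hωW z hz w hw])
        (fun z hz h => hker' z hz fun v => by rw [← hS, h, map_zero, LinearMap.zero_apply])
    have hσ := lorentzSign_mul_self (K := K) (Y := Y)
    obtain ⟨hl, ⟨A⟩⟩ := exists_adaptedFrame hlam hsymm hωskew hωcocycle b hb (fun _ => rfl)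
      (fun _ => rfl) (fun k p => hcen.1 (hbW k) p) (fun z hz i => hbo z (hcen.2 hz) i)
      (fun p q i => by rw [hsymm, hbo _ (hmem p q)]) (fun k l => hωW _ (hbW k) _ (hbW l))
      (fun k h => hker' _ (hbW k) h)
      (fun k l hkl => by
        have h := hSo k l hkl
        rw [form_eq_sum_of_orthonormal b hσ hb, Fintype.sum_sum_type] at h
        simpa [-Fintype.sum_option, hS, hωW _ (hbW _) _ (hbW _), lorentzSign] using h)
      (fun y => by rw [← hS, hSY]) (by rwa [← hS])
      (fun p q => by
        have h := hRic p q
        rw [trace_ad_comp_adjoint b hσ hb hadStar, trace_J_comp_J b hσ hb hJm,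
          form_skew_sq b hσ hb hωskew hS] at h
        linarith)
      (by
        rw [trace_skew_sq b hσ hb hωskew hS] at htr
        linarith)
    refine ⟨hl, ?_⟩
    rcases one_or_two_of_dotProduct_relations A.μ_ne_zero A.μ_sq A.dot_a_self A.dot_x_self
      A.dot_a_a A.dot_x_a_sq with
      ⟨k, hk⟩ | ⟨k, l, hkl, hK⟩
    · exact Or.inl (A.exists_basis_five hsymm k hk)
    · exact Or.inr (A.exists_basis_six hsymm k l hkl hK)
  · rintro ⟨rfl, ⟨b, α, s, ε, horth, h0, h1, hα, hs, hε, h23, h34, hlie, h14, h02, hω⟩ |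
      ⟨b, α₂, α₃, s, ε, horth, h0, h1, hα₂, hα₃, hs, hε, h34, h35, h45, hlie, h15, h24, h03, hω⟩⟩
    · exact quasiEinstein_five hωskew hS hadStar hJm b horth h0 h1 hα hs hε h23 h34 hlie h14 h02 hω
    · exact quasiEinstein_six hωskew hS hadStar hJm b horth h0 h1 hα₂ hα₃ hs hε
        (Real.sq_sqrt (by positivity)) h34 h35 h45 hlie h15 h24 h03 hω
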